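/- arXiv:2310.13497 — 2 statements merged into one kernel-verified Lean document; each statement's English description precedes it below -/
import Mathlib

section
/- Let b ∈ (1/2,1) and b′ ∈ (b−1,0). There exists C > 0 such that for all Schwartz functions u₁, u₂ on ℝ² and all t ∈ (0,1], | ∫₀ᵗ ∫_ℝ u₁(σ,x) · conj(u₂(σ,x)) dx dσ | ≤ C ‖u₁‖_{X^{0,b′}} ‖u₂‖_{X^{0,b}}. -/
open MeasureTheory

noncomputable section

/-- Spacetime Fourier transform on ℝ². -/
def FT2 (u : ℝ × ℝ → ℂ) (τ ξ : ℝ) : ℂ :=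
  ∫ p : ℝ × ℝ, Complex.exp (-(Complex.I * ((p.1 * τ + p.2 * ξ : ℝ) : ℂ))) * u p

/-- Bourgain weight ⟨ξ⟩^{2s}⟨τ-ξ³⟩^{2b}, with ⟨x⟩ = (1+x²)^{1/2}. -/
def wgt (s b τ ξ : ℝ) : ℝ := (1 + ξ ^ 2) ^ s * (1 + (τ - ξ ^ 3) ^ 2) ^ b

/-- The Bourgain norm ‖u‖_{X^{s,b}}. -/
def Xnorm (s b : ℝ) (u : ℝ × ℝ → ℂ) : ℝ :=
  Real.sqrt (∫ q : ℝ × ℝ, wgt s b q.1 q.2 * ‖FT2 u q.1 q.2‖ ^ 2)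

theorem lintegral_mul_le_sqrt_mul_sqrt {α : Type*} [MeasurableSpace α] (μ : Measure α)
    {f g : α → ENNReal} (hf : Measurable f) (hg : Measurable g) :
    ∫⁻ a, f a * g a ∂μ ≤
      (∫⁻ a, f a ^ 2 ∂μ) ^ (1 / 2 : ℝ) * (∫⁻ a, g a ^ 2 ∂μ) ^ (1 / 2 : ℝ) := by
  have h := ENNReal.lintegral_mul_le_Lp_mul_Lq μ (p := 2) (q := 2)
    Real.HolderConjugate.two_two hf.aemeasurable hg.aemeasurable
  simpa using h

theorem lintegral_mul_kernel_le_of_sq {F G A B : ℝ → ENNReal} (hF : Measurable F)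
    (hG : Measurable G) (hA : Measurable A) (hB : Measurable B) :
    ∫⁻ p : ℝ × ℝ, F p.1 * G p.2 * (A (p.1 - p.2) * B p.2) ≤
      ((∫⁻ x, A x ^ 2) * ∫⁻ x, B x ^ 2) ^ (1 / 2 : ℝ) *
        ((∫⁻ x, F x ^ 2) ^ (1 / 2 : ℝ) * (∫⁻ x, G x ^ 2) ^ (1 / 2 : ℝ)) := by
  refine (lintegral_mul_le_sqrt_mul_sqrt volume (f := fun p : ℝ × ℝ => F p.1 * G p.2)
    (g := fun p : ℝ × ℝ => A (p.1 - p.2) * B p.2) (by fun_prop) (by fun_prop)).trans ?_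
  have h1 : ∫⁻ p : ℝ × ℝ, (F p.1 * G p.2) ^ 2 = (∫⁻ x, F x ^ 2) * ∫⁻ x, G x ^ 2 := by
    simp_rw [mul_pow]
    exact lintegral_prod_mul (f := fun x => F x ^ 2) (g := fun x => G x ^ 2)
      (by fun_prop) (by fun_prop)
  have h2 : ∫⁻ p : ℝ × ℝ, (A (p.1 - p.2) * B p.2) ^ 2 = (∫⁻ x, A x ^ 2) * ∫⁻ x, B x ^ 2 := by
    simp_rw [mul_pow]
    rw [Measure.volume_eq_prod, lintegral_prod_symm _ (by fun_prop)]
    have (y : ℝ) : ∫⁻ x, A (x - y) ^ 2 * B y ^ 2 = (∫⁻ x, A x ^ 2) * B y ^ 2 := by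
      rw [lintegral_mul_const _ (by fun_prop), lintegral_sub_right_eq_self (fun x => A x ^ 2)]
    simp_rw [this]
    rw [lintegral_const_mul _ (by fun_prop)]
  rw [h1, h2, ENNReal.mul_rpow_of_nonneg (∫⁻ x, F x ^ 2) _ (by norm_num), mul_comm]

theorem lintegral_mul_convolution_kernel_le {F G A : ℝ → ENNReal} (hF : Measurable F)
    (hG : Measurable G) (hA : Measurable A) :
    ∫⁻ p : ℝ × ℝ, F p.1 * G p.2 * A (p.1 - p.2) ^ 2 ≤
      (∫⁻ x, A x ^ 2) *
        ((∫⁻ x, F x ^ 2) ^ (1 / 2 : ℝ) * (∫⁻ x, G x ^ 2) ^ (1 / 2 : ℝ)) := by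
  have h := lintegral_mul_le_sqrt_mul_sqrt volume (f := fun p : ℝ × ℝ => F p.1 * A (p.1 - p.2))
    (g := fun p : ℝ × ℝ => G p.2 * A (p.1 - p.2)) (by fun_prop) (by fun_prop)
  have h1 : ∫⁻ p : ℝ × ℝ, (F p.1 * A (p.1 - p.2)) ^ 2 = (∫⁻ x, F x ^ 2) * ∫⁻ x, A x ^ 2 := by
    simp_rw [mul_pow]
    rw [Measure.volume_eq_prod, lintegral_prod _ (by fun_prop)]
    have (x : ℝ) : ∫⁻ y, F x ^ 2 * A (x - y) ^ 2 = F x ^ 2 * (∫⁻ x, A x ^ 2) := by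
      rw [lintegral_const_mul _ (by fun_prop), lintegral_sub_left_eq_self (fun x => A x ^ 2)]
    simp_rw [this]
    rw [lintegral_mul_const _ (by fun_prop)]
  have h2 : ∫⁻ p : ℝ × ℝ, (G p.2 * A (p.1 - p.2)) ^ 2 = (∫⁻ x, G x ^ 2) * ∫⁻ x, A x ^ 2 := by
    simp_rw [mul_pow]
    rw [Measure.volume_eq_prod, lintegral_prod_symm _ (by fun_prop)]
    have (y : ℝ) : ∫⁻ x, G y ^ 2 * A (x - y) ^ 2 = G y ^ 2 * (∫⁻ x, A x ^ 2) := by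
      rw [lintegral_const_mul _ (by fun_prop), lintegral_sub_right_eq_self (fun x => A x ^ 2)]
    simp_rw [this]
    rw [lintegral_mul_const _ (by fun_prop)]
  have hS : (∫⁻ x, A x ^ 2) ^ (1 / 2 : ℝ) * (∫⁻ x, A x ^ 2) ^ (1 / 2 : ℝ) = ∫⁻ x, A x ^ 2 := by
    rw [← ENNReal.rpow_add_of_nonneg _ _ (by norm_num) (by norm_num)]
    norm_num
  rw [h1, h2, ENNReal.mul_rpow_of_nonneg _ _ (by norm_num),
    ENNReal.mul_rpow_of_nonneg _ _ (by norm_num)] at h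
  calc _ = ∫⁻ p : ℝ × ℝ, F p.1 * A (p.1 - p.2) * (G p.2 * A (p.1 - p.2)) := by
        congr 1; ext p; ring
    _ ≤ _ := h
    _ = _ := by conv_rhs => rw [← hS]
                ring

theorem one_add_sub_sq_rpow_neg_half_le {b b' : ℝ} (hb : 1 / 2 < b) (hb' : b - 1 < b')
    (hb'0 : b' < 0) (x y : ℝ) :
    (1 + (x - y) ^ 2) ^ (-1 / 2 : ℝ) ≤
      2 * ((1 + x ^ 2) ^ (b' / 2) * (1 + y ^ 2) ^ (b / 2) *
        ((1 + (x - y) ^ 2) ^ ((-b' - 1) / 2) * (1 + y ^ 2) ^ (-b / 2) +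
          ((1 + (x - y) ^ 2) ^ (-(1 + (b + b')) / 4)) ^ 2)) := by
  have hX : 1 ≤ 1 + (x - y) ^ 2 := by nlinarith [sq_nonneg (x - y)]
  have hY : 1 ≤ 1 + y ^ 2 := by nlinarith [sq_nonneg y]
  have hZ : 1 ≤ 1 + x ^ 2 := by nlinarith [sq_nonneg x]
  have hZXY : 1 + x ^ 2 ≤ 2 * ((1 + (x - y) ^ 2) + (1 + y ^ 2)) := by
    nlinarith [sq_nonneg (x - y - y)]
  generalize 1 + (x - y) ^ 2 = X at *
  generalize 1 + y ^ 2 = Y at *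
  generalize 1 + x ^ 2 = Z at *
  have hX0 : 0 < X := by linarith
  have hY0 : 0 < Y := by linarith
  have hZ0 : 0 < Z := by linarith
  have key {M : ℝ} (hM : 0 < M) (h : Z ≤ 4 * M) : 1 ≤ 2 * (Z ^ (b' / 2) * M ^ (-b' / 2)) := by
    have h1 : (4 * M) ^ (b' / 2) ≤ Z ^ (b' / 2) :=
      Real.rpow_le_rpow_of_nonpos hZ0 h (by linarith)
    have h4 : (4 : ℝ) ^ (-(1 / 2) : ℝ) ≤ 4 ^ (b' / 2) :=
      Real.rpow_le_rpow_of_exponent_le (by norm_num) (by linarith)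
    have h5 : (4 : ℝ) ^ (-(1 / 2) : ℝ) = 1 / 2 := by
      rw [show (4 : ℝ) = 2 ^ (2 : ℝ) by norm_num, ← Real.rpow_mul (by norm_num)]
      norm_num [Real.rpow_neg_one]
    rw [Real.mul_rpow (by norm_num) hM.le] at h1
    have h6 : M ^ (b' / 2) * M ^ (-b' / 2) = 1 := by
      rw [← Real.rpow_add hM]; ring_nf; exact Real.rpow_zero _
    have h7 : 0 < M ^ (-b' / 2) := Real.rpow_pos_of_pos hM _
    have h8 : 4 ^ (b' / 2) * M ^ (b' / 2) * M ^ (-b' / 2) ≤ Z ^ (b' / 2) * M ^ (-b' / 2) := by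
      gcongr
    rw [mul_assoc, h6] at h8
    linarith
  have hsq : (X ^ (-(1 + (b + b')) / 4)) ^ 2 = X ^ (-(1 + (b + b')) / 2) := by
    rw [← Real.rpow_natCast, ← Real.rpow_mul hX0.le]; congr 1; push_cast; ring
  have hXr := Real.rpow_pos_of_pos hX0
  have hYr := Real.rpow_pos_of_pos hY0
  have hZr := Real.rpow_pos_of_pos hZ0
  rw [hsq]
  rcases le_total Y X with h | h
  · have k := key hX0 (by linarith)
    have e : X ^ ((-b' - 1) / 2) = X ^ (-b' / 2) * X ^ (-1 / 2 : ℝ) := by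
      rw [← Real.rpow_add hX0]; ring_nf
    have e' : Y ^ (b / 2) * Y ^ (-b / 2) = 1 := by
      rw [← Real.rpow_add hY0]; ring_nf; exact Real.rpow_zero _
    calc X ^ (-1 / 2 : ℝ) ≤ 2 * (Z ^ (b' / 2) * X ^ (-b' / 2)) * X ^ (-1 / 2 : ℝ) :=
          le_mul_of_one_le_left (hXr _).le k
      _ = 2 * (Z ^ (b' / 2) * Y ^ (b / 2) * (X ^ ((-b' - 1) / 2) * Y ^ (-b / 2) + 0)) := by
          rw [e]; linear_combination (-2 * Z ^ (b' / 2) * X ^ (-b' / 2) * X ^ (-1 / 2 : ℝ)) * e'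
      _ ≤ _ := by
          have := (hZr (b' / 2)).le; have := (hYr (b / 2)).le
          gcongr; exact (hXr _).le
  · have k := key hY0 (by linarith)
    have e : X ^ (-(1 + (b + b')) / 2) = X ^ (-(b + b') / 2) * X ^ (-1 / 2 : ℝ) := by
      rw [← Real.rpow_add hX0]; ring_nf
    have e' : Y ^ (b / 2) * Y ^ (-(b + b') / 2) = Y ^ (-b' / 2) := by
      rw [← Real.rpow_add hY0]; ring_nf
    have e'' : Y ^ (-(b + b') / 2) ≤ X ^ (-(b + b') / 2) :=
      Real.rpow_le_rpow_of_nonpos hX0 h (by linarith)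
    calc X ^ (-1 / 2 : ℝ) ≤ 2 * (Z ^ (b' / 2) * Y ^ (-b' / 2)) * X ^ (-1 / 2 : ℝ) :=
          le_mul_of_one_le_left (hXr _).le k
      _ = 2 * (Z ^ (b' / 2) * Y ^ (b / 2) * (0 + Y ^ (-(b + b') / 2) * X ^ (-1 / 2 : ℝ))) := by
          rw [← e']; ring
      _ ≤ _ := by
          rw [e]
          have := (hZr (b' / 2)).le; have := (hYr (b / 2)).le; have := (hXr (-1 / 2)).le
          gcongr; exact mul_nonneg (hXr _).le (hYr _).le

theorem lintegral_one_add_sq_rpow_sq_lt_top {r : ℝ} (hr : r < -1 / 4) :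
    ∫⁻ x : ℝ, ENNReal.ofReal ((1 + x ^ 2) ^ r) ^ 2 < ⊤ := by
  have h := (integrable_rpow_neg_one_add_norm_sq (E := ℝ) (μ := volume) (r := -4 * r)
    (by simp; linarith)).lintegral_lt_top
  convert h using 3 with x
  have : 0 < 1 + x ^ 2 := by positivity
  rw [← ENNReal.ofReal_pow (by positivity), ← Real.rpow_natCast, ← Real.rpow_mul this.le,
    Real.norm_eq_abs, sq_abs]
  congr 2; push_cast; ring

/-- The weighted `L²` bilinear estimate for the kernel `⟨x - y⟩⁻¹`. -/
theorem exists_lintegral_mul_japanese_kernel_le {b b' : ℝ} (hb : 1 / 2 < b)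
    (hb' : b - 1 < b') (hb'0 : b' < 0) :
    ∃ C : ENNReal, C ≠ ⊤ ∧ ∀ F G : ℝ → ENNReal, Measurable F → Measurable G → ∀ c : ℝ,
      ∫⁻ p : ℝ × ℝ, F p.1 * G p.2 * ENNReal.ofReal ((1 + (p.1 - p.2) ^ 2) ^ (-1 / 2 : ℝ)) ≤
        C * ((∫⁻ x, ENNReal.ofReal ((1 + (x - c) ^ 2) ^ b') * F x ^ 2) ^ (1 / 2 : ℝ) *
          (∫⁻ x, ENNReal.ofReal ((1 + (x - c) ^ 2) ^ b) * G x ^ 2) ^ (1 / 2 : ℝ)) := by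
  set A : ℝ → ENNReal := fun x => ENNReal.ofReal ((1 + x ^ 2) ^ ((-b' - 1) / 2)) with hA
  set B : ℝ → ENNReal := fun x => ENNReal.ofReal ((1 + x ^ 2) ^ (-b / 2)) with hB
  set D : ℝ → ENNReal := fun x => ENNReal.ofReal ((1 + x ^ 2) ^ (-(1 + (b + b')) / 4)) with hD
  have hAm : Measurable A := by fun_prop
  have hBm : Measurable B := by fun_prop
  have hDm : Measurable D := by fun_prop
  refine ⟨2 * (((∫⁻ x, A x ^ 2) * ∫⁻ x, B x ^ 2) ^ (1 / 2 : ℝ) + ∫⁻ x, D x ^ 2), ?_, ?_⟩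
  · have hA2 := lintegral_one_add_sq_rpow_sq_lt_top (r := (-b' - 1) / 2) (by linarith)
    have hB2 := lintegral_one_add_sq_rpow_sq_lt_top (r := -b / 2) (by linarith)
    have hD2 := lintegral_one_add_sq_rpow_sq_lt_top (r := -(1 + (b + b')) / 4) (by linarith)
    exact ENNReal.mul_ne_top (by simp) (ENNReal.add_ne_top.2
      ⟨ENNReal.rpow_ne_top_of_nonneg (by norm_num) (ENNReal.mul_ne_top hA2.ne hB2.ne), hD2.ne⟩)
  intro F G hF hG c
  have hsq (s x : ℝ) : ENNReal.ofReal ((1 + x ^ 2) ^ (s / 2)) ^ 2 =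
      ENNReal.ofReal ((1 + x ^ 2) ^ s) := by
    have : 0 < 1 + x ^ 2 := by positivity
    rw [← ENNReal.ofReal_pow (by positivity), ← Real.rpow_natCast, ← Real.rpow_mul this.le]
    congr 2; push_cast; ring
  set F' : ℝ → ENNReal := fun x => ENNReal.ofReal ((1 + x ^ 2) ^ (b' / 2)) * F (x + c) with hF'
  set G' : ℝ → ENNReal := fun x => ENNReal.ofReal ((1 + x ^ 2) ^ (b / 2)) * G (x + c) with hG'
  have hFm : Measurable F' := by fun_prop
  have hGm : Measurable G' := by fun_prop
  have hI (s : ℝ) (H : ℝ → ENNReal) :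
      ∫⁻ x, ENNReal.ofReal ((1 + (x - c) ^ 2) ^ s) * H x ^ 2 =
        ∫⁻ x, (ENNReal.ofReal ((1 + x ^ 2) ^ (s / 2)) * H (x + c)) ^ 2 := by
    rw [← lintegral_add_right_eq_self _ c]
    simp_rw [mul_pow, hsq, add_sub_cancel_right]
  rw [hI, hI]
  calc ∫⁻ p : ℝ × ℝ, F p.1 * G p.2 * ENNReal.ofReal ((1 + (p.1 - p.2) ^ 2) ^ (-1 / 2 : ℝ))
      = ∫⁻ p : ℝ × ℝ, F (p.1 + c) * G (p.2 + c) *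
          ENNReal.ofReal ((1 + (p.1 - p.2) ^ 2) ^ (-1 / 2 : ℝ)) := by
        rw [← lintegral_add_right_eq_self _ ((c, c) : ℝ × ℝ)]
        simp
    _ ≤ ∫⁻ p : ℝ × ℝ, 2 * (F' p.1 * G' p.2 * (A (p.1 - p.2) * B p.2) +
          F' p.1 * G' p.2 * D (p.1 - p.2) ^ 2) := by
        refine lintegral_mono fun p => ?_
        have h := ENNReal.ofReal_le_ofReal
          (one_add_sub_sq_rpow_neg_half_le hb hb' hb'0 p.1 p.2)
        refine (mul_le_mul_right h _).trans (le_of_eq ?_)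
        rw [ENNReal.ofReal_mul (by norm_num), ENNReal.ofReal_mul (by positivity),
          ENNReal.ofReal_mul (by positivity), ENNReal.ofReal_add (by positivity) (by positivity),
          ENNReal.ofReal_mul (by positivity), ENNReal.ofReal_pow (by positivity)]
        simp only [hF', hG', hA, hB, hD, ENNReal.ofReal_ofNat]
        ring
    _ = 2 * ((∫⁻ p : ℝ × ℝ, F' p.1 * G' p.2 * (A (p.1 - p.2) * B p.2)) +
          ∫⁻ p : ℝ × ℝ, F' p.1 * G' p.2 * D (p.1 - p.2) ^ 2) := by
        rw [lintegral_const_mul _ (by fun_prop), lintegral_add_left (by fun_prop)]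
    _ ≤ _ := by
        refine (mul_le_mul_right (add_le_add (lintegral_mul_kernel_le_of_sq hFm hGm hAm hBm)
          (lintegral_mul_convolution_kernel_le hFm hGm hDm)) _).trans (le_of_eq ?_)
        ring

theorem SchwartzMap.exists_norm_le_inv_one_add_sq (F : SchwartzMap (ℝ × ℝ) ℂ) :
    ∃ C : ℝ, 0 ≤ C ∧ ∀ x y : ℝ, ‖F (x, y)‖ ≤ C * ((1 + x ^ 2)⁻¹ ^ 2 * (1 + y ^ 2)⁻¹ ^ 2) := by
  refine ⟨2 ^ 8 * ((Finset.Iic ((8, 0) : ℕ × ℕ)).sup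
    fun m => SchwartzMap.seminorm ℝ m.1 m.2) F, by positivity, fun x y => ?_⟩
  have h := SchwartzMap.one_add_le_sup_seminorm_apply (𝕜 := ℝ) (m := (8, 0)) le_rfl le_rfl F (x, y)
  rw [norm_iteratedFDeriv_zero] at h
  have hp : 0 < (1 + x ^ 2) ^ 2 * (1 + y ^ 2) ^ 2 := by positivity
  rw [inv_pow, inv_pow, ← mul_inv, le_mul_inv_iff₀ hp, mul_comm]
  refine le_trans ?_ h
  gcongr
  have hx : |x| ≤ ‖(x, y)‖ := norm_fst_le (x, y)
  have hy : |y| ≤ ‖(x, y)‖ := norm_snd_le (x, y)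
  have h1 : 1 + x ^ 2 ≤ (1 + ‖(x, y)‖) ^ 2 := by
    rw [← sq_abs x]; nlinarith [abs_nonneg x]
  have h2 : 1 + y ^ 2 ≤ (1 + ‖(x, y)‖) ^ 2 := by
    rw [← sq_abs y]; nlinarith [abs_nonneg y]
  calc (1 + x ^ 2) ^ 2 * (1 + y ^ 2) ^ 2
      ≤ ((1 + ‖(x, y)‖) ^ 2) ^ 2 * ((1 + ‖(x, y)‖) ^ 2) ^ 2 := by gcongr
    _ = _ := by ring

theorem SchwartzMap.exists_coe_eq_FT2 (u : SchwartzMap (ℝ × ℝ) ℂ) :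
    ∃ F : SchwartzMap (ℝ × ℝ) ℂ, ∀ τ ξ : ℝ, F (τ, ξ) = FT2 u τ ξ := by
  let e := WithLp.prodContinuousLinearEquiv 2 ℝ ℝ ℝ
  have hc : (2 * Real.pi)⁻¹ ≠ 0 := by positivity
  let s : (ℝ × ℝ) ≃L[ℝ] ℝ × ℝ := ContinuousLinearEquiv.smulLeft (Units.mk0 _ hc)
  refine ⟨SchwartzMap.compCLMOfContinuousLinearEquiv ℂ (s.trans e.symm)
    (FourierTransform.fourier (SchwartzMap.compCLMOfContinuousLinearEquiv ℂ e u)), fun τ ξ => ?_⟩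
  rw [SchwartzMap.compCLMOfContinuousLinearEquiv_apply, Function.comp_apply,
    SchwartzMap.fourier_coe, Real.fourier_eq', FT2,
    ← (WithLp.volume_preserving_toLp ℝ ℝ).integral_comp
      (MeasurableEquiv.toLp 2 (ℝ × ℝ)).measurableEmbedding]
  refine integral_congr_ae (ae_of_all _ fun p => ?_)
  have h1 : (SchwartzMap.compCLMOfContinuousLinearEquiv ℂ e u) (WithLp.toLp 2 p) = u p := rfl
  have h2 : (s.trans e.symm) (τ, ξ) =
      WithLp.toLp 2 ((2 * Real.pi)⁻¹ * τ, (2 * Real.pi)⁻¹ * ξ) := rfl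
  dsimp only
  rw [h1, h2, smul_eq_mul, WithLp.prod_inner_apply]
  congr 2
  simp only [RCLike.inner_apply, conj_trivial]
  push_cast
  have : (Real.pi : ℂ) ≠ 0 := by exact_mod_cast Real.pi_ne_zero
  field_simp

/-- Partial Fourier transform in the second variable. -/
def partialFT (u : ℝ × ℝ → ℂ) (σ ξ : ℝ) : ℂ :=
  ∫ x : ℝ, Complex.exp (-(Complex.I * ((x * ξ : ℝ) : ℂ))) * u (σ, x)

theorem norm_exp_neg_I_mul (x : ℝ) : ‖Complex.exp (-(Complex.I * (x : ℂ)))‖ = 1 := by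
  rw [Complex.norm_exp]; simp

theorem SchwartzMap.continuous_partialFT (u : SchwartzMap (ℝ × ℝ) ℂ) (ξ : ℝ) :
    Continuous fun σ => partialFT u σ ξ := by
  obtain ⟨C, hC, hu⟩ := u.exists_norm_le_inv_one_add_sq
  refine continuous_of_dominated (bound := fun x => C * (1 + x ^ 2)⁻¹) (fun σ => ?_)
    (fun σ => ae_of_all _ fun x => ?_) (integrable_inv_one_add_sq.const_mul C)
    (ae_of_all _ fun x => ?_)
  · have := u.continuous
    exact Continuous.aestronglyMeasurable (by fun_prop)
  · rw [norm_mul, norm_exp_neg_I_mul, one_mul]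
    refine (hu σ x).trans ?_
    have h1 : (1 + σ ^ 2)⁻¹ ≤ 1 := inv_le_one_of_one_le₀ (by nlinarith [sq_nonneg σ])
    have h2 : (1 + x ^ 2)⁻¹ ≤ 1 := inv_le_one_of_one_le₀ (by nlinarith [sq_nonneg x])
    gcongr
    calc (1 + σ ^ 2)⁻¹ ^ 2 * (1 + x ^ 2)⁻¹ ^ 2 ≤ 1 ^ 2 * ((1 + x ^ 2)⁻¹ * 1) := by
          rw [sq (1 + x ^ 2)⁻¹]; gcongr
      _ = _ := by ring
  · have := u.continuous
    fun_prop

theorem SchwartzMap.integrable_FT2_integrand (u : SchwartzMap (ℝ × ℝ) ℂ) (τ ξ : ℝ) :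
    Integrable fun p : ℝ × ℝ =>
      Complex.exp (-(Complex.I * ((p.1 * τ + p.2 * ξ : ℝ) : ℂ))) * u p := by
  refine u.integrable.bdd_mul (c := 1) ?_ (ae_of_all _ fun p => (norm_exp_neg_I_mul _).le)
  exact Continuous.aestronglyMeasurable (by fun_prop)

theorem SchwartzMap.integral_exp_mul_partialFT (u : SchwartzMap (ℝ × ℝ) ℂ) (τ ξ : ℝ) :
    ∫ σ : ℝ, Complex.exp (-(Complex.I * ((σ * τ : ℝ) : ℂ))) * partialFT u σ ξ = FT2 u τ ξ := by
  rw [FT2, Measure.volume_eq_prod, integral_prod _ (u.integrable_FT2_integrand τ ξ)]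
  refine integral_congr_ae (ae_of_all _ fun σ => ?_)
  simp only [partialFT]
  rw [← integral_const_mul]
  refine integral_congr_ae (ae_of_all _ fun x => ?_)
  dsimp only
  rw [← mul_assoc, ← Complex.exp_add]
  congr 2
  push_cast
  ring

theorem SchwartzMap.integrable_partialFT (u : SchwartzMap (ℝ × ℝ) ℂ) (ξ : ℝ) :
    Integrable fun σ => partialFT u σ ξ := by
  have h := u.integrable_FT2_integrand 0 ξ
  rw [Measure.volume_eq_prod] at h
  simpa [partialFT] using h.integral_prod_left

theorem SchwartzMap.integrable_FT2_left (u : SchwartzMap (ℝ × ℝ) ℂ) (ξ : ℝ) :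
    Integrable fun τ => FT2 u τ ξ := by
  obtain ⟨F, hF⟩ := u.exists_coe_eq_FT2
  obtain ⟨C, hC, h⟩ := F.exists_norm_le_inv_one_add_sq
  simp_rw [← hF]
  refine (integrable_inv_one_add_sq.const_mul C).mono'
    (F.continuous.comp (by fun_prop : Continuous fun τ : ℝ => (τ, ξ))).aestronglyMeasurable
    (ae_of_all _ fun τ => (h τ ξ).trans ?_)
  have h1 : (1 + ξ ^ 2)⁻¹ ≤ 1 := inv_le_one_of_one_le₀ (by nlinarith [sq_nonneg ξ])
  have h2 : (1 + τ ^ 2)⁻¹ ≤ 1 := inv_le_one_of_one_le₀ (by nlinarith [sq_nonneg τ])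
  gcongr
  calc (1 + τ ^ 2)⁻¹ ^ 2 * (1 + ξ ^ 2)⁻¹ ^ 2 ≤ ((1 + τ ^ 2)⁻¹ * 1) * 1 ^ 2 := by
        rw [sq (1 + τ ^ 2)⁻¹]; gcongr
    _ = _ := by ring

/-- Fourier inversion in the time variable. -/
theorem SchwartzMap.partialFT_eq_integral_FT2 (u : SchwartzMap (ℝ × ℝ) ℂ) (σ ξ : ℝ) :
    partialFT u σ ξ =
      (2 * Real.pi : ℂ)⁻¹ * ∫ τ : ℝ, Complex.exp (Complex.I * ((σ * τ : ℝ) : ℂ)) * FT2 u τ ξ := by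
  have hF : FourierTransform.fourier (fun σ => partialFT u σ ξ) =
      fun w : ℝ => FT2 u (2 * Real.pi * w) ξ := by
    ext w
    rw [Real.fourier_real_eq_integral_exp_smul, ← u.integral_exp_mul_partialFT]
    refine integral_congr_ae (ae_of_all _ fun x => ?_)
    dsimp only
    rw [smul_eq_mul]
    congr 2
    push_cast
    ring
  have hi : Integrable (FourierTransform.fourier (fun σ => partialFT u σ ξ)) := by
    rw [hF]
    exact (u.integrable_FT2_left ξ).comp_mul_left' (by positivity)
  have h := congrFun ((u.continuous_partialFT ξ).fourierInv_fourier_eq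
    (u.integrable_partialFT ξ) hi) σ
  rw [← h, hF, Real.fourierInv_eq']
  have h2 := Measure.integral_comp_mul_left
    (fun τ : ℝ => Complex.exp (Complex.I * ((σ * τ : ℝ) : ℂ)) * FT2 u τ ξ) (2 * Real.pi)
  rw [abs_of_pos (by positivity), Complex.real_smul] at h2
  push_cast at h2 ⊢
  rw [← h2]
  refine integral_congr_ae (ae_of_all _ fun x => ?_)
  simp only [smul_eq_mul, RCLike.inner_apply, conj_trivial]
  congr 2
  push_cast
  ring

/-- Plancherel's identity in the space variable. -/
theorem SchwartzMap.integral_slice_mul_conj (u v : SchwartzMap (ℝ × ℝ) ℂ) (σ : ℝ) :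
    ∫ x : ℝ, u (σ, x) * (starRingEnd ℂ) (v (σ, x)) =
      (2 * Real.pi : ℂ)⁻¹ * ∫ ξ : ℝ, partialFT u σ ξ * (starRingEnd ℂ) (partialFT v σ ξ) := by
  have hg : (fun x : ℝ => (σ, x)).HasTemperateGrowth := by
    have h : (fun x : ℝ => (σ, x)) = fun x : ℝ => (σ, (0 : ℝ)) + ContinuousLinearMap.inr ℝ ℝ ℝ x := by
      ext x <;> simp
    rw [h]
    fun_prop
  have ha : AntilipschitzWith 1 (fun x : ℝ => (σ, x)) :=
    AntilipschitzWith.of_le_mul_dist fun x y => by simp [Prod.dist_eq]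
  let S := SchwartzMap.compCLMOfAntilipschitz (F := ℂ) ℂ hg ha
  have hS (w : SchwartzMap (ℝ × ℝ) ℂ) (η : ℝ) :
      FourierTransform.fourier (S w) η = partialFT w σ (2 * Real.pi * η) := by
    rw [SchwartzMap.fourier_coe, Real.fourier_real_eq_integral_exp_smul, partialFT]
    refine integral_congr_ae (ae_of_all _ fun x => ?_)
    dsimp only
    rw [smul_eq_mul, show S w x = w (σ, x) from rfl]
    congr 2
    push_cast
    ring
  have h := SchwartzMap.integral_inner_fourier_fourier (S v) (S u)
  simp_rw [hS, RCLike.inner_apply] at h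
  have h2 := Measure.integral_comp_mul_left
    (fun ξ : ℝ => partialFT u σ ξ * (starRingEnd ℂ) (partialFT v σ ξ)) (2 * Real.pi)
  rw [abs_of_pos (by positivity), Complex.real_smul] at h2
  push_cast at h2
  rw [← h2, h]
  rfl

theorem norm_integral_exp_I_mul_le {t : ℝ} (ht : 0 < t) (ht1 : t ≤ 1) (x : ℝ) :
    ‖∫ σ in (0 : ℝ)..t, Complex.exp (Complex.I * ((σ * x : ℝ) : ℂ))‖ ≤
      3 * (1 + x ^ 2) ^ (-1 / 2 : ℝ) := by
  have hn (y : ℝ) : ‖Complex.exp (Complex.I * (y : ℂ))‖ = 1 := by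
    rw [Complex.norm_exp]; simp
  have hs : (1 + x ^ 2) ^ (-1 / 2 : ℝ) = (Real.sqrt (1 + x ^ 2))⁻¹ := by
    rw [neg_div, Real.rpow_neg (by positivity), ← Real.sqrt_eq_rpow]
  have hp : 0 < Real.sqrt (1 + x ^ 2) := by positivity
  rw [hs, ← div_eq_mul_inv, le_div_iff₀ hp]
  rcases le_total |x| 1 with h | h
  · have h1 : ‖∫ σ in (0 : ℝ)..t, Complex.exp (Complex.I * ((σ * x : ℝ) : ℂ))‖ ≤ 1 := by
      refine (intervalIntegral.norm_integral_le_of_norm_le_const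
        (C := 1) fun σ _ => (hn _).le).trans ?_
      rw [sub_zero, abs_of_pos ht, one_mul]; exact ht1
    have h2 : Real.sqrt (1 + x ^ 2) ≤ 3 := by
      rw [Real.sqrt_le_left (by norm_num)]
      nlinarith [sq_abs x, abs_nonneg x]
    nlinarith
  · have hx : x ≠ 0 := by rintro rfl; norm_num at h
    have hxp : 0 < |x| := by linarith
    have hc : Complex.I * (x : ℂ) ≠ 0 := mul_ne_zero Complex.I_ne_zero (by exact_mod_cast hx)
    have e : ∫ σ in (0 : ℝ)..t, Complex.exp (Complex.I * ((σ * x : ℝ) : ℂ)) =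
        ∫ σ in (0 : ℝ)..t, Complex.exp (Complex.I * (x : ℂ) * σ) := by
      congr 1; ext σ; congr 1; push_cast; ring
    have h1 : ‖∫ σ in (0 : ℝ)..t, Complex.exp (Complex.I * ((σ * x : ℝ) : ℂ))‖ ≤ 2 / |x| := by
      rw [e, integral_exp_mul_complex hc, norm_div, norm_mul, Complex.norm_I, one_mul,
        Complex.norm_real, Real.norm_eq_abs]
      gcongr
      refine (norm_sub_le _ _).trans (le_of_eq ?_)
      have := hn (x * t)
      push_cast at this
      rw [mul_assoc, this]
      norm_num
    have h2 : Real.sqrt (1 + x ^ 2) ≤ 3 / 2 * |x| := by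
      rw [Real.sqrt_le_left (by positivity)]
      nlinarith [sq_abs x, abs_nonneg x]
    calc _ ≤ 2 / |x| * (3 / 2 * |x|) := by gcongr
      _ = 3 := by field_simp

theorem SchwartzMap.continuous_FT2 (u : SchwartzMap (ℝ × ℝ) ℂ) :
    Continuous fun q : ℝ × ℝ => FT2 u q.1 q.2 := by
  obtain ⟨F, hF⟩ := u.exists_coe_eq_FT2
  simp_rw [← hF]
  exact F.continuous

theorem SchwartzMap.exists_norm_FT2_le (u : SchwartzMap (ℝ × ℝ) ℂ) :
    ∃ C : ℝ, 0 ≤ C ∧ ∀ τ ξ : ℝ, ‖FT2 u τ ξ‖ ≤ C * ((1 + τ ^ 2)⁻¹ ^ 2 * (1 + ξ ^ 2)⁻¹ ^ 2) := by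
  obtain ⟨F, hF⟩ := u.exists_coe_eq_FT2
  simp_rw [← hF]
  exact F.exists_norm_le_inv_one_add_sq

theorem SchwartzMap.integrable_wgt_mul_norm_FT2_sq (u : SchwartzMap (ℝ × ℝ) ℂ) {s : ℝ}
    (hs : s ≤ 1) :
    Integrable fun q : ℝ × ℝ => wgt 0 s q.1 q.2 * ‖FT2 u q.1 q.2‖ ^ 2 := by
  obtain ⟨C, hC, h⟩ := u.exists_norm_FT2_le
  have hint : Integrable fun q : ℝ × ℝ => 2 * C ^ 2 * ((1 + q.1 ^ 2)⁻¹ * (1 + q.2 ^ 2)⁻¹) :=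
    (integrable_inv_one_add_sq.mul_prod integrable_inv_one_add_sq).const_mul _
  refine hint.mono' ?_ (ae_of_all _ fun q => ?_)
  · have hw : Continuous fun q : ℝ × ℝ => wgt 0 s q.1 q.2 := by
      simp only [wgt, Real.rpow_zero, one_mul]
      exact Continuous.rpow_const (by fun_prop) fun q => Or.inl (by positivity)
    exact (hw.mul (u.continuous_FT2.norm.pow 2)).aestronglyMeasurable
  · obtain ⟨τ, ξ⟩ := q
    have hw : wgt 0 s τ ξ ≤ 2 * ((1 + τ ^ 2) * (1 + ξ ^ 2) ^ 3) := by
      rw [wgt, Real.rpow_zero, one_mul]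
      have h1 : 1 ≤ 1 + (τ - ξ ^ 3) ^ 2 := by nlinarith [sq_nonneg (τ - ξ ^ 3)]
      refine (Real.rpow_le_rpow_of_exponent_le h1 hs).trans ?_
      rw [Real.rpow_one]
      have h2 : 0 ≤ ξ ^ 2 := sq_nonneg ξ
      have h3 : 1 + ξ ^ 6 ≤ (1 + ξ ^ 2) ^ 3 := by nlinarith [pow_nonneg h2 2]
      have h4 : 0 ≤ ξ ^ 6 := by positivity
      nlinarith [sq_nonneg (τ + ξ ^ 3), mul_nonneg (sq_nonneg τ) h4,
        mul_le_mul_of_nonneg_left h3 (by positivity : 0 ≤ 1 + τ ^ 2)]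
    have hw0 : 0 ≤ wgt 0 s τ ξ := by rw [wgt]; positivity
    dsimp only
    rw [Real.norm_of_nonneg (by positivity)]
    have hξ : (1 + ξ ^ 2)⁻¹ * (1 + ξ ^ 2) = 1 := inv_mul_cancel₀ (by positivity)
    have hτ : (1 + τ ^ 2)⁻¹ * (1 + τ ^ 2) = 1 := inv_mul_cancel₀ (by positivity)
    have h1 : (1 + τ ^ 2)⁻¹ ≤ 1 := inv_le_one_of_one_le₀ (by nlinarith [sq_nonneg τ])
    calc wgt 0 s τ ξ * ‖FT2 u τ ξ‖ ^ 2
        ≤ 2 * ((1 + τ ^ 2) * (1 + ξ ^ 2) ^ 3) *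
          (C * ((1 + τ ^ 2)⁻¹ ^ 2 * (1 + ξ ^ 2)⁻¹ ^ 2)) ^ 2 := by
          gcongr; exact h τ ξ
      _ = 2 * C ^ 2 * (((1 + τ ^ 2)⁻¹ * (1 + τ ^ 2)) * (1 + τ ^ 2)⁻¹ ^ 3 *
          (((1 + ξ ^ 2)⁻¹ * (1 + ξ ^ 2)) ^ 3 * (1 + ξ ^ 2)⁻¹)) := by ring
      _ = 2 * C ^ 2 * ((1 + τ ^ 2)⁻¹ ^ 2 * (1 + τ ^ 2)⁻¹ * (1 + ξ ^ 2)⁻¹) := by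
          rw [hξ, hτ]; ring
      _ ≤ 2 * C ^ 2 * (1 ^ 2 * (1 + τ ^ 2)⁻¹ * (1 + ξ ^ 2)⁻¹) := by gcongr
      _ = _ := by ring

theorem SchwartzMap.ofReal_Xnorm (u : SchwartzMap (ℝ × ℝ) ℂ) {s : ℝ} (hs : s ≤ 1) :
    ENNReal.ofReal (Xnorm 0 s u) =
      (∫⁻ ξ, ∫⁻ τ, ENNReal.ofReal ((1 + (τ - ξ ^ 3) ^ 2) ^ s) *
        ‖FT2 u τ ξ‖ₑ ^ 2) ^ (1 / 2 : ℝ) := by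
  have hi := u.integrable_wgt_mul_norm_FT2_sq hs
  have h0 (q : ℝ × ℝ) : 0 ≤ wgt 0 s q.1 q.2 * ‖FT2 u q.1 q.2‖ ^ 2 := by
    rw [wgt]; positivity
  have hw (q : ℝ × ℝ) : ENNReal.ofReal (wgt 0 s q.1 q.2 * ‖FT2 u q.1 q.2‖ ^ 2) =
      ENNReal.ofReal ((1 + (q.1 - q.2 ^ 3) ^ 2) ^ s) * ‖FT2 u q.1 q.2‖ₑ ^ 2 := by
    rw [wgt, Real.rpow_zero, one_mul, ENNReal.ofReal_mul (by positivity),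
      ENNReal.ofReal_pow (by positivity), ofReal_norm]
  have hm := u.continuous_FT2.measurable
  rw [Xnorm, Real.sqrt_eq_rpow, ← ENNReal.ofReal_rpow_of_nonneg (integral_nonneg h0) (by norm_num),
    ofReal_integral_eq_lintegral_ofReal hi (ae_of_all _ h0)]
  simp_rw [hw]
  rw [Measure.volume_eq_prod, lintegral_prod_symm _ (by fun_prop)]

theorem SchwartzMap.integrable_FT2_mul_conj_FT2 (u v : SchwartzMap (ℝ × ℝ) ℂ) :
    Integrable fun q : ℝ × ℝ × ℝ => FT2 u q.2.1 q.1 * (starRingEnd ℂ) (FT2 v q.2.2 q.1) := by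
  obtain ⟨C, hC, hu⟩ := u.exists_norm_FT2_le
  obtain ⟨D, hD, hv⟩ := v.exists_norm_FT2_le
  have hint : Integrable fun q : ℝ × ℝ × ℝ =>
      C * D * ((1 + q.1 ^ 2)⁻¹ * ((1 + q.2.1 ^ 2)⁻¹ * (1 + q.2.2 ^ 2)⁻¹)) :=
    (integrable_inv_one_add_sq.mul_prod
      (integrable_inv_one_add_sq.mul_prod integrable_inv_one_add_sq)).const_mul _
  refine hint.mono' ?_ (ae_of_all _ fun q => ?_)
  · have hcu := u.continuous_FT2.comp (by fun_prop : Continuous fun q : ℝ × ℝ × ℝ => (q.2.1, q.1))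
    have hcv := v.continuous_FT2.comp (by fun_prop : Continuous fun q : ℝ × ℝ × ℝ => (q.2.2, q.1))
    exact (hcu.mul (Complex.continuous_conj.comp hcv)).aestronglyMeasurable
  · obtain ⟨ξ, τ, τ'⟩ := q
    have h1 (x : ℝ) : (1 + x ^ 2)⁻¹ ≤ 1 := inv_le_one_of_one_le₀ (by nlinarith [sq_nonneg x])
    dsimp only
    rw [norm_mul, RCLike.norm_conj]
    calc ‖FT2 u τ ξ‖ * ‖FT2 v τ' ξ‖
        ≤ (C * ((1 + τ ^ 2)⁻¹ ^ 2 * (1 + ξ ^ 2)⁻¹ ^ 2)) *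
          (D * ((1 + τ' ^ 2)⁻¹ ^ 2 * (1 + ξ ^ 2)⁻¹ ^ 2)) := by
          gcongr
          exacts [hu τ ξ, hv τ' ξ]
      _ = C * D * ((1 + ξ ^ 2)⁻¹ * ((1 + τ ^ 2)⁻¹ * (1 + τ' ^ 2)⁻¹)) *
          ((1 + τ ^ 2)⁻¹ * (1 + τ' ^ 2)⁻¹ * (1 + ξ ^ 2)⁻¹ ^ 3) := by ring
      _ ≤ C * D * ((1 + ξ ^ 2)⁻¹ * ((1 + τ ^ 2)⁻¹ * (1 + τ' ^ 2)⁻¹)) * (1 * 1 * 1 ^ 3) := by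
          gcongr <;> exact h1 _
      _ = _ := by ring

theorem SchwartzMap.integral_slice_mul_conj_eq_integral_FT2 (u v : SchwartzMap (ℝ × ℝ) ℂ)
    (σ : ℝ) :
    ∫ x : ℝ, u (σ, x) * (starRingEnd ℂ) (v (σ, x)) =
      (2 * Real.pi : ℂ)⁻¹ ^ 3 * ∫ q : ℝ × ℝ × ℝ,
        Complex.exp (Complex.I * ((σ * (q.2.1 - q.2.2) : ℝ) : ℂ)) *
          (FT2 u q.2.1 q.1 * (starRingEnd ℂ) (FT2 v q.2.2 q.1)) := by
  have hi : Integrable fun q : ℝ × ℝ × ℝ =>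
      Complex.exp (Complex.I * ((σ * (q.2.1 - q.2.2) : ℝ) : ℂ)) *
        (FT2 u q.2.1 q.1 * (starRingEnd ℂ) (FT2 v q.2.2 q.1)) := by
    refine (u.integrable_FT2_mul_conj_FT2 v).bdd_mul (c := 1) ?_ (ae_of_all _ fun q => ?_)
    · exact Continuous.aestronglyMeasurable (by fun_prop)
    · rw [Complex.norm_exp]; simp
  rw [u.integral_slice_mul_conj v, Measure.volume_eq_prod, integral_prod _ hi, pow_succ', mul_assoc,
    ← integral_const_mul ((2 * Real.pi : ℂ)⁻¹ ^ 2)]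
  congr 1
  refine integral_congr_ae (ae_of_all _ fun ξ => ?_)
  dsimp only
  rw [u.partialFT_eq_integral_FT2, v.partialFT_eq_integral_FT2, map_mul, ← integral_conj,
    mul_mul_mul_comm, ← integral_prod_mul]
  congr 1
  · simp [sq, Complex.conj_ofNat]
  · refine integral_congr_ae (ae_of_all _ fun p => ?_)
    dsimp only
    rw [map_mul, mul_mul_mul_comm, ← Complex.exp_conj, ← Complex.exp_add]
    congr 2
    simp only [map_mul, Complex.conj_I, Complex.conj_ofReal]
    push_cast
    ring

theorem SchwartzMap.integral_time_slice_mul_conj (u v : SchwartzMap (ℝ × ℝ) ℂ) {t : ℝ}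
    (ht : 0 < t) :
    ∫ σ in (0 : ℝ)..t, ∫ x : ℝ, u (σ, x) * (starRingEnd ℂ) (v (σ, x)) =
      (2 * Real.pi : ℂ)⁻¹ ^ 3 * ∫ q : ℝ × ℝ × ℝ,
        (∫ σ in (0 : ℝ)..t, Complex.exp (Complex.I * ((σ * (q.2.1 - q.2.2) : ℝ) : ℂ))) *
          (FT2 u q.2.1 q.1 * (starRingEnd ℂ) (FT2 v q.2.2 q.1)) := by
  simp_rw [u.integral_slice_mul_conj_eq_integral_FT2 v]
  rw [intervalIntegral.integral_const_mul]
  congr 1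
  simp_rw [intervalIntegral.integral_of_le ht.le]
  rw [integral_integral_swap]
  · simp_rw [integral_mul_const]
  · refine ((u.integrable_FT2_mul_conj_FT2 v).comp_snd _).bdd_mul (c := 1) ?_
      (ae_of_all _ fun q => ?_)
    · exact Continuous.aestronglyMeasurable (by fun_prop)
    · rw [Complex.norm_exp]; simp

theorem SchwartzMap.enorm_integral_time_slice_mul_conj_le (u v : SchwartzMap (ℝ × ℝ) ℂ) {t : ℝ}
    (ht : 0 < t) (ht1 : t ≤ 1) :
    ‖∫ σ in (0 : ℝ)..t, ∫ x : ℝ, u (σ, x) * (starRingEnd ℂ) (v (σ, x))‖ₑ ≤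
      3 * ∫⁻ ξ : ℝ, ∫⁻ p : ℝ × ℝ, ‖FT2 u p.1 ξ‖ₑ * ‖FT2 v p.2 ξ‖ₑ *
        ENNReal.ofReal ((1 + (p.1 - p.2) ^ 2) ^ (-1 / 2 : ℝ)) := by
  have hc : ‖(2 * Real.pi : ℂ)⁻¹ ^ 3‖ₑ ≤ 1 := by
    rw [← ofReal_norm, ENNReal.ofReal_le_one, norm_pow, norm_inv]
    refine pow_le_one₀ (by positivity) (inv_le_one_of_one_le₀ ?_)
    rw [norm_mul, Complex.norm_real, Real.norm_of_nonneg Real.pi_pos.le, Complex.norm_ofNat]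
    linarith [Real.pi_gt_three]
  have hu := u.continuous_FT2.measurable.comp
    (by fun_prop : Measurable fun q : ℝ × ℝ × ℝ => (q.2.1, q.1))
  have hv := v.continuous_FT2.measurable.comp
    (by fun_prop : Measurable fun q : ℝ × ℝ × ℝ => (q.2.2, q.1))
  simp only [Function.comp_def] at hu hv
  rw [u.integral_time_slice_mul_conj v ht, enorm_mul]
  refine (mul_le_of_le_one_left' hc).trans ((enorm_integral_le_lintegral_enorm _).trans ?_)
  calc _ ≤ ∫⁻ q : ℝ × ℝ × ℝ, 3 * (‖FT2 u q.2.1 q.1‖ₑ * ‖FT2 v q.2.2 q.1‖ₑ *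
        ENNReal.ofReal ((1 + (q.2.1 - q.2.2) ^ 2) ^ (-1 / 2 : ℝ))) := by
        refine lintegral_mono fun q => ?_
        have h := ENNReal.ofReal_le_ofReal (norm_integral_exp_I_mul_le ht ht1 (q.2.1 - q.2.2))
        rw [ofReal_norm, ENNReal.ofReal_mul (by norm_num), ENNReal.ofReal_ofNat] at h
        rw [enorm_mul, enorm_mul, RCLike.enorm_conj]
        refine (mul_le_mul_left h _).trans (le_of_eq (by ring))
    _ = _ := by
        rw [lintegral_const_mul _ (by fun_prop), Measure.volume_eq_prod,
          lintegral_prod _ (by fun_prop)]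

theorem time_cauchy_schwarz (b b' : ℝ) (hb : 1/2 < b) (hb1 : b < 1)
    (hb' : b - 1 < b') (hb'0 : b' < 0) :
    ∃ C > 0, ∀ u₁ u₂ : SchwartzMap (ℝ × ℝ) ℂ, ∀ t : ℝ, 0 < t → t ≤ 1 →
      ‖∫ σ in (0:ℝ)..t, ∫ x : ℝ, u₁ (σ, x) * (starRingEnd ℂ) (u₂ (σ, x))‖ ≤
        C * Xnorm 0 b' ⇑u₁ * Xnorm 0 b ⇑u₂ := by
  obtain ⟨C, hC, h⟩ := exists_lintegral_mul_japanese_kernel_le hb hb' hb'0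
  refine ⟨3 * C.toReal + 1, by positivity, fun u v t ht ht1 => ?_⟩
  have hX (s : ℝ) (w : SchwartzMap (ℝ × ℝ) ℂ) : 0 ≤ Xnorm 0 s w := Real.sqrt_nonneg _
  refine (ENNReal.ofReal_le_ofReal_iff (mul_nonneg (mul_nonneg (by positivity) (hX _ _))
    (hX _ _))).1 ?_
  have hu := u.continuous_FT2.measurable
  have hv := v.continuous_FT2.measurable
  have hsq (a : ENNReal) : (a ^ (1 / 2 : ℝ)) ^ 2 = a := by
    rw [← ENNReal.rpow_natCast, ← ENNReal.rpow_mul]; norm_num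
  have hmeas (s : ℝ) (w : SchwartzMap (ℝ × ℝ) ℂ) : Measurable fun ξ : ℝ =>
      (∫⁻ τ, ENNReal.ofReal ((1 + (τ - ξ ^ 3) ^ 2) ^ s) * ‖FT2 w τ ξ‖ₑ ^ 2) ^ (1 / 2 : ℝ) := by
    have hw := w.continuous_FT2.measurable
    refine Measurable.pow_const (Measurable.lintegral_prod_left' (f := fun q : ℝ × ℝ =>
      ENNReal.ofReal ((1 + (q.1 - q.2 ^ 3) ^ 2) ^ s) * ‖FT2 w q.1 q.2‖ₑ ^ 2) ?_) _
    fun_prop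
  have hCle : 3 * C ≤ ENNReal.ofReal (3 * C.toReal + 1) := by
    rw [ENNReal.ofReal_add (by positivity) (by norm_num), ENNReal.ofReal_mul (by norm_num),
      ENNReal.ofReal_toReal hC, ENNReal.ofReal_ofNat]
    exact le_self_add
  rw [ofReal_norm, ENNReal.ofReal_mul (mul_nonneg (by positivity) (hX _ _)),
    ENNReal.ofReal_mul (by positivity), u.ofReal_Xnorm (by linarith), v.ofReal_Xnorm hb1.le]
  refine (u.enorm_integral_time_slice_mul_conj_le v ht ht1).trans ?_
  refine (mul_le_mul_right (lintegral_mono fun ξ => h (fun τ => ‖FT2 u τ ξ‖ₑ)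
    (fun τ => ‖FT2 v τ ξ‖ₑ) (hu.comp (by fun_prop : Measurable fun τ : ℝ => (τ, ξ))).enorm
    (hv.comp (by fun_prop : Measurable fun τ : ℝ => (τ, ξ))).enorm (ξ ^ 3)) 3).trans ?_
  have hCS := lintegral_mul_le_sqrt_mul_sqrt volume (hmeas b' u) (hmeas b v)
  simp_rw [hsq] at hCS
  rw [lintegral_const_mul' _ _ hC]
  refine (mul_le_mul_right (mul_le_mul_right hCS C) 3).trans ?_
  rw [← mul_assoc, mul_assoc (ENNReal.ofReal _)]
  gcongr

end
end

section
/- Let k ≥ 2, s, s₁,…,s_k ∈ ℝ, and let M : ℝ^k → [0,∞) be a measurable multiplier of polynomial growth. Suppose there exist a nonempty proper subset A of the index set {0,1,…,k}, measurable functions M₁, M₂ : ℝ^k → [0,∞), a constant C₀ > 0 and θ ∈ (0,1) such that (M₁M₂)^{1/2} = M · ⟨ξ⟩^{s} / ∏_{j=1}^k ⟨ξ_j⟩^{s_j} pointwise (with ξ = ξ₁+⋯+ξ_k identified with the index 0 variable ξ₀), and such that for all K > 0: S_A(M₁,K) + S_{Aᶜ}(M₂,K) ≤ C₀ K^{θ},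 where for a subset B of {0,…,k}, S_B(M',K) denotes the supremum over α ∈ ℝ and over fixed values of the variables ξ_j, j ∉ B, of the integral of M′ · 1_{|Φ−α| < K} over the variables ξ_j, j ∈ B, constrained to the hyperplane ξ₀ = ξ₁+⋯+ξ_k (an affine integral in |B|−1 free variables), and Φ = ξ₀³ − ξ₁³ − ⋯ − ξ_k³. Then there exist b ∈ (1/2,1), b′ ∈ (b−1,0) and C > 0 such that for all Schwartz functions v₁,…,v_k on ℝ²: ‖M^∨(v₁,…,v_k)‖_{X^{s,b′}} ≤ C ∏_{j=1}^k ‖v_j‖_{X^{s_j,b}}. -/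
open MeasureTheory

noncomputable section

/-- Extend `k-1` frequencies to `k` with the last determined by the total `tot`. -/
def padTot (k : ℕ) (tot : ℝ) (v : Fin (k - 1) → ℝ) : Fin k → ℝ :=
  fun j => if h : (j : ℕ) < k - 1 then v ⟨j, h⟩ else tot - ∑ i, v i

/-- Spacetime Fourier transform of M^∨(u₁,…,u_k) at (τ,ξ). -/
def convFT (k : ℕ) (M : (Fin k → ℝ) → ℂ) (u : Fin k → ℝ × ℝ → ℂ) (τ ξ : ℝ) : ℂ :=
  ∫ q : Fin (k - 1) → ℝ × ℝ,
    M (padTot k ξ fun i => (q i).2) *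
      ∏ j, FT2 (u j) (padTot k τ (fun i => (q i).1) j) (padTot k ξ (fun i => (q i).2) j)

/-- The Bourgain norm ‖M^∨(u₁,…,u_k)‖_{X^{s,b}}. -/
def XnormM (s b : ℝ) (k : ℕ) (M : (Fin k → ℝ) → ℂ) (u : Fin k → ℝ × ℝ → ℂ) : ℝ :=
  Real.sqrt (∫ q : ℝ × ℝ, wgt s b q.1 q.2 * ‖convFT k M u q.1 q.2‖ ^ 2)

/-- The variables (ξ₁,…,ξ_k) of a full vector (ξ₀,ξ₁,…,ξ_k). -/
def tailVec (k : ℕ) (η : Fin (k + 1) → ℝ) : Fin k → ℝ := fun i => η i.succ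

/-- The resonance function Φ = ξ₀³ − ξ₁³ − ⋯ − ξ_k³. -/
def PhiFull (k : ℕ) (η : Fin (k + 1) → ℝ) : ℝ := (η 0) ^ 3 - ∑ i : Fin k, (η i.succ) ^ 3

/-- Replace the `j₀` coordinate of `v` so that the constraint ξ₀ = ξ₁+⋯+ξ_k holds. -/
def completeAt (k : ℕ) (j₀ : Fin (k + 1)) (v : Fin (k + 1) → ℝ) : Fin (k + 1) → ℝ :=
  Function.update v j₀
    (if j₀ = 0 then ∑ i : Fin k, v i.succ
     else v 0 - ∑ i : Fin k, if i.succ = j₀ then 0 else v i.succ)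

/-- Build the full frequency vector: coordinates outside `B` are fixed by `g`, the
coordinates in `B` other than `j₀` are the free variables `h`, and the `j₀` coordinate is
determined by the hyperplane constraint ξ₀ = ξ₁+⋯+ξ_k. -/
def buildVec (k : ℕ) (B : Finset (Fin (k + 1))) (j₀ : Fin (k + 1))
    (g : Fin (k + 1) → ℝ) (h : {j // j ∈ B.erase j₀} → ℝ) : Fin (k + 1) → ℝ :=
  completeAt k j₀ (fun j => if hj : j ∈ B.erase j₀ then h ⟨j, hj⟩ else g j)

/-- The frequency-restricted bound S_B(M',K) ≤ C₀ K^θ: for every K > 0, α ∈ ℝ, every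
parametrization of the constrained set and all fixed outside variables, the affine integral
of M'·1_{|Φ−α|<K} over the variables in `B` is at most C₀ K^θ. -/
def FreqRestricted (k : ℕ) (M' : (Fin k → ℝ) → ℝ) (B : Finset (Fin (k + 1)))
    (C₀ θ : ℝ) : Prop :=
  ∀ K : ℝ, 0 < K → ∀ α : ℝ, ∀ j₀ ∈ B, ∀ g : Fin (k + 1) → ℝ,
    (∫⁻ h : {j // j ∈ B.erase j₀} → ℝ,
        ENNReal.ofReal (M' (tailVec k (buildVec k B j₀ g h)) *
          (if |PhiFull k (buildVec k B j₀ g h) - α| < K then 1 else 0)))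
      ≤ ENNReal.ofReal (C₀ * K ^ θ)

/-- The spacetime Fourier transform of a Schwartz function is a Schwartz function. -/
theorem exists_schwartz_FT2 (u : SchwartzMap (ℝ × ℝ) ℂ) :
    ∃ U : SchwartzMap (ℝ × ℝ) ℂ, ∀ τ ξ, FT2 u τ ξ = U (τ, ξ) := by
  let e := WithLp.prodContinuousLinearEquiv 2 ℝ ℝ ℝ
  let u' : SchwartzMap (WithLp 2 (ℝ × ℝ)) ℂ := SchwartzMap.compCLMOfContinuousLinearEquiv ℝ e u
  let d : (ℝ × ℝ) ≃L[ℝ] (ℝ × ℝ) :=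
    ContinuousLinearEquiv.smulLeft (Units.mk0 ((2 * Real.pi)⁻¹ : ℝ) (by positivity))
  refine ⟨SchwartzMap.compCLMOfContinuousLinearEquiv ℝ (d.trans e.symm)
    (FourierTransform.fourier u'), fun τ ξ => ?_⟩
  rw [SchwartzMap.compCLMOfContinuousLinearEquiv_apply, Function.comp_apply,
    SchwartzMap.fourier_coe, Real.fourier_eq', FT2,
    ← (WithLp.volume_preserving_ofLp (U := ℝ) (V := ℝ)).integral_comp
      (MeasurableEquiv.toLp 2 (ℝ × ℝ)).symm.measurableEmbedding]
  refine integral_congr_ae (Filter.Eventually.of_forall fun p => ?_)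
  simp only [smul_eq_mul]
  congr 2
  simp [d, e, ContinuousLinearEquiv.smulLeft, WithLp.prod_inner_apply, Units.smul_def]
  field_simp

/-- The Bourgain weight has at most polynomial growth. -/
theorem wgt_le_pow (s b : ℝ) : ∃ N : ℕ, ∃ C : ℝ, 0 ≤ C ∧
    ∀ q : ℝ × ℝ, wgt s b q.1 q.2 ≤ C * (1 + ‖q‖) ^ N := by
  have key : ∀ r x : ℝ, (1 + x ^ 2) ^ r ≤ (1 + x ^ 2) ^ ⌈r⌉₊ := fun r x => by
    rw [← Real.rpow_natCast (1 + x ^ 2)]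
    exact Real.rpow_le_rpow_of_exponent_le (le_add_of_nonneg_right (sq_nonneg x)) (Nat.le_ceil r)
  refine ⟨2 * ⌈s⌉₊ + 6 * ⌈b⌉₊, 5 ^ ⌈b⌉₊, by positivity, fun q => ?_⟩
  have h1 : |q.1| ≤ ‖q‖ := norm_fst_le q
  have h2 : |q.2| ≤ ‖q‖ := norm_snd_le q
  set R := 1 + ‖q‖
  have hR : 1 ≤ R := by simp [R]
  have e1 : 1 + q.2 ^ 2 ≤ R ^ 2 := by
    rw [← sq_abs q.2]; simp only [R]; nlinarith [abs_nonneg q.2, norm_nonneg q]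
  have e2 : |q.1 - q.2 ^ 3| ≤ 2 * R ^ 3 := by
    have h3 : |q.2| ^ 3 ≤ R ^ 3 := by gcongr; simp only [R]; linarith
    have h4 : |q.1| ≤ R ^ 3 := (show |q.1| ≤ R by simp only [R]; linarith).trans
      (le_self_pow₀ hR (by norm_num))
    calc _ ≤ |q.1| + |q.2 ^ 3| := abs_sub _ _
      _ ≤ _ := by rw [abs_pow]; linarith
  have e3 : 1 + (q.1 - q.2 ^ 3) ^ 2 ≤ 5 * R ^ 6 := by
    have h5 : (q.1 - q.2 ^ 3) ^ 2 ≤ (2 * R ^ 3) ^ 2 := by rw [← sq_abs]; gcongr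
    have h6 : 1 ≤ R ^ 6 := one_le_pow₀ hR
    nlinarith
  calc wgt s b q.1 q.2 ≤ (1 + q.2 ^ 2) ^ ⌈s⌉₊ * (1 + (q.1 - q.2 ^ 3) ^ 2) ^ ⌈b⌉₊ := by
        unfold wgt; gcongr <;> apply key
    _ ≤ (R ^ 2) ^ ⌈s⌉₊ * (5 * R ^ 6) ^ ⌈b⌉₊ := by gcongr
    _ = _ := by rw [mul_pow, ← pow_mul, ← pow_mul]; ring

theorem wgt_nonneg (s b τ ξ : ℝ) : 0 ≤ wgt s b τ ξ := by
  unfold wgt; positivity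

theorem measurable_wgt (s b : ℝ) : Measurable fun q : ℝ × ℝ => wgt s b q.1 q.2 := by
  unfold wgt; fun_prop

theorem integrable_wgt_mul (s b : ℝ) (u : SchwartzMap (ℝ × ℝ) ℂ) :
    Integrable fun q : ℝ × ℝ => wgt s b q.1 q.2 * ‖FT2 u q.1 q.2‖ ^ 2 := by
  obtain ⟨U, hU⟩ := exists_schwartz_FT2 u
  obtain ⟨N, C, hC, h⟩ := wgt_le_pow s b
  simp only [hU]
  have hb := SchwartzMap.one_add_le_sup_seminorm_apply (𝕜 := ℝ) (m := (N, 0)) le_rfl le_rfl U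
  set D := 2 ^ N * (Finset.Iic ((N, 0) : ℕ × ℕ)).sup (fun m => SchwartzMap.seminorm ℝ m.1 m.2) U
  refine ((U.integrable.norm.const_mul (C * D))).mono' ?_ (Filter.Eventually.of_forall fun q => ?_)
  · exact ((measurable_wgt s b).mul (U.continuous.norm.pow 2).measurable).aestronglyMeasurable
  · have h1 := h q
    have h2 := hb q
    simp only [norm_iteratedFDeriv_zero] at h2
    rw [Real.norm_of_nonneg (mul_nonneg (wgt_nonneg ..) (by positivity))]
    calc _ ≤ (C * (1 + ‖q‖) ^ N) * ‖U q‖ ^ 2 := by gcongr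
      _ = C * ((1 + ‖q‖) ^ N * ‖U q‖) * ‖U q‖ := by ring
      _ ≤ C * D * ‖U q‖ := by gcongr

/-- The sign pattern `(-1, 1, …, 1)` of the hyperplane `ξ₀ = ξ₁ + ⋯ + ξ_k`. -/
def hypSign (k : ℕ) : Fin (k + 1) → ℤ := Fin.cons (-1) fun _ => 1

theorem hypSign_mul_self (k : ℕ) (j : Fin (k + 1)) : hypSign k j * hypSign k j = 1 := by
  refine Fin.cases ?_ (fun i => ?_) j <;> simp [hypSign]

section Hyperplane

variable {G : Type*} [AddCommGroup G] {k : ℕ}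

/-- The linear form defining the hyperplane `ξ₀ = ξ₁ + ⋯ + ξ_k`. -/
def hypForm (v : Fin (k + 1) → G) : G := ∑ j, hypSign k j • v j

/-- Move the coordinate `j₀` so that the point lies on the hyperplane. -/
def hypProj (j₀ : Fin (k + 1)) (v : Fin (k + 1) → G) : Fin (k + 1) → G :=
  Function.update v j₀ (v j₀ - hypSign k j₀ • hypForm v)

theorem hypForm_eq (v : Fin (k + 1) → G) : hypForm v = -v 0 + ∑ i : Fin k, v i.succ := by
  simp [hypForm, Fin.sum_univ_succ, hypSign]

theorem hypForm_update (v : Fin (k + 1) → G) (j : Fin (k + 1)) (t : G) :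
    hypForm (Function.update v j t) = hypForm v + hypSign k j • (t - v j) := by
  unfold hypForm
  rw [← Finset.add_sum_erase _ _ (Finset.mem_univ j), ← Finset.add_sum_erase Finset.univ
    (fun i => hypSign k i • v i) (Finset.mem_univ j), Function.update_self,
    Finset.sum_congr rfl (g := fun i => hypSign k i • v i)
      (fun i hi => by rw [Function.update_of_ne (Finset.ne_of_mem_erase hi)]), smul_sub]
  abel

theorem hypForm_hypProj (j : Fin (k + 1)) (v : Fin (k + 1) → G) : hypForm (hypProj j v) = 0 := by
  rw [hypProj, hypForm_update, sub_sub_cancel_left, smul_neg, smul_smul, hypSign_mul_self]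
  simp

theorem hypProj_of_ne {i j : Fin (k + 1)} (h : i ≠ j) (v : Fin (k + 1) → G) :
    hypProj j v i = v i := Function.update_of_ne h _ _

theorem hypProj_eq_of_eq_off {j : Fin (k + 1)} {v w : Fin (k + 1) → G} (hv : hypForm v = 0)
    (h : ∀ i ≠ j, w i = v i) : hypProj j w = v := by
  have hw : w = Function.update v j (w j) := by
    ext i
    by_cases hi : i = j
    · subst hi; simp
    · simp [hi, h i hi]
  have h1 : hypForm w = hypSign k j • (w j - v j) := by rw [hw, hypForm_update, hv]; simp
  ext i
  by_cases hi : i = j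
  · subst hi
    rw [hypProj, Function.update_self, h1, smul_smul, hypSign_mul_self]
    simp
  · rw [hypProj_of_ne hi, h i hi]

theorem hypProj_exchange {i j : Fin (k + 1)} (hij : i ≠ j) (x : Fin (k + 1) → G) (t : G) :
    hypProj i (Function.update x j t) = hypProj j (Function.update x i
      (x i - hypSign k i • (hypForm x - hypSign k j • x j) - (hypSign k i * hypSign k j) • t)) := by
  symm
  refine hypProj_eq_of_eq_off (hypForm_hypProj _ _) fun l hl => ?_
  by_cases hli : l = i
  · subst hli
    rw [hypProj, Function.update_self, Function.update_self, Function.update_of_ne hij,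
      hypForm_update, mul_smul, smul_sub, smul_sub, smul_add, smul_sub]
    abel_nf
  · rw [hypProj_of_ne hli, Function.update_of_ne hli, Function.update_of_ne hl]

theorem completeAt_eq_hypProj (j : Fin (k + 1)) (v : Fin (k + 1) → ℝ) :
    completeAt k j v = hypProj j v := by
  unfold completeAt hypProj
  congr 1
  refine Fin.cases ?_ (fun i => ?_) j
  · simp [hypForm_eq, hypSign]
  · have : ∀ x, (if x = i then 0 else v x.succ) = v x.succ - if x = i then v x.succ else 0 :=
      fun x => by split_ifs <;> simp
    simp [hypForm_eq, hypSign, this]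
    ring

end Hyperplane

theorem hypProj_fst {k : ℕ} (j : Fin (k + 1)) (v : Fin (k + 1) → ℝ × ℝ) (i : Fin (k + 1)) :
    (hypProj j v i).1 = hypProj j (fun l => (v l).1) i := by
  by_cases hi : i = j
  · subst hi; simp [hypProj, hypForm, Prod.fst_sum]
  · simp [hypProj_of_ne hi]

theorem hypProj_snd {k : ℕ} (j : Fin (k + 1)) (v : Fin (k + 1) → ℝ × ℝ) (i : Fin (k + 1)) :
    (hypProj j v i).2 = hypProj j (fun l => (v l).2) i := by
  by_cases hi : i = j
  · subst hi; simp [hypProj, hypForm, Prod.snd_sum]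
  · simp [hypProj_of_ne hi]

theorem measurable_hypProj {k : ℕ} {G : Type*} [AddCommGroup G] [MeasurableSpace G]
    [MeasurableAdd₂ G] [MeasurableSub₂ G] [MeasurableConstSMul ℤ G] (j : Fin (k + 1)) :
    Measurable (hypProj j : (Fin (k + 1) → G) → _) := by
  have h : Measurable (hypForm : (Fin (k + 1) → G) → G) := by
    unfold hypForm
    exact Finset.measurable_fun_sum _ fun i _ => (measurable_const_smul _).comp (measurable_pi_apply i)
  refine measurable_pi_iff.2 fun i => ?_
  by_cases hi : i = j
  · subst hi
    simp only [hypProj, Function.update_self]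
    exact (measurable_pi_apply i).sub ((measurable_const_smul _).comp h)
  · simp only [hypProj_of_ne hi]
    exact measurable_pi_apply i

theorem measurable_hypProj_prod {k : ℕ} (j : Fin (k + 1)) :
    Measurable (hypProj j : (Fin (k + 1) → ℝ × ℝ) → _) := by
  have : MeasurableConstSMul ℤ (ℝ × ℝ) := ⟨fun c => (continuous_const_smul c).measurable⟩
  exact measurable_hypProj j

/-- The affine measure on the hyperplane does not depend on the choice of the
dependent variable. -/
theorem lmarginal_hypProj_eq {k : ℕ} (S : Finset (Fin (k + 1))) {i j : Fin (k + 1)}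
    (hi : i ∈ S) (hj : j ∈ S) {F : (Fin (k + 1) → ℝ × ℝ) → ENNReal} (hF : Measurable F) :
    lmarginal (fun _ => volume) (S.erase i) (fun v => F (hypProj i v)) =
      lmarginal (fun _ => volume) (S.erase j) (fun v => F (hypProj j v)) := by
  by_cases hij : i = j
  · rw [hij]
  have hm : ∀ l, Measurable fun v => F (hypProj l v) := fun l =>
    hF.comp (measurable_hypProj_prod l)
  rw [lmarginal_erase' _ (hm i) (Finset.mem_erase.2 ⟨Ne.symm hij, hj⟩),
    lmarginal_erase' _ (hm j) (Finset.mem_erase.2 ⟨hij, hi⟩),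
    Finset.erase_right_comm]
  congr 1
  ext x
  simp_rw [hypProj_exchange hij]
  generalize x i - hypSign k i • (hypForm x - hypSign k j • x j) = c
  have hs : hypSign k i * hypSign k j = 1 ∨ hypSign k i * hypSign k j = -1 := by
    refine Int.isUnit_iff.1 (IsUnit.mul ?_ ?_) <;>
    exact IsUnit.of_mul_eq_one _ (hypSign_mul_self _ _)
  rcases hs with hs | hs
  · simp only [hs, one_smul]
    exact lintegral_sub_left_eq_self (fun t => F (hypProj j (Function.update x i t))) c
  · simp only [hs, neg_smul, one_smul, sub_neg_eq_add]
    exact lintegral_add_left_eq_self (fun t => F (hypProj j (Function.update x i t))) c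

/-- Tonelli for products of functions of separate variables. -/
theorem lmarginal_prod {ι X : Type*} [DecidableEq ι] [MeasureSpace X]
    [SigmaFinite (volume : Measure X)] (S : Finset ι) (f : ι → X → ENNReal)
    (hf : ∀ i, Measurable (f i)) (x : ι → X) :
    lmarginal (fun _ => volume) S (fun v => ∏ i ∈ S, f i (v i)) x = ∏ i ∈ S, ∫⁻ t, f i t := by
  have hm : ∀ T : Finset ι, Measurable fun v : ι → X => ∏ i ∈ T, f i (v i) := fun T =>
    Finset.measurable_fun_prod _ fun i _ => (hf i).comp (measurable_pi_apply i)
  induction S using Finset.induction_on generalizing x with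
  | empty => simp
  | insert a S ha ih =>
    rw [lmarginal_insert' _ (hm _) ha, Finset.prod_insert ha, ← ih x]
    simp only [lmarginal]
    have hm' : Measurable fun y : S → X => ∏ i ∈ S, f i (Function.updateFinset x S y i) :=
      (hm S).comp measurable_updateFinset
    rw [← lintegral_const_mul _ hm']
    congr 1
    ext y
    rw [← lintegral_mul_const _ (hf a)]
    congr 1
    ext t
    rw [Finset.prod_insert ha, Function.update_self]
    congr 1
    exact Finset.prod_congr rfl fun i hi => by
      rw [Function.update_of_ne (ne_of_mem_of_not_mem hi ha)]

theorem lintegral_pi_prod {ι X : Type*} [Fintype ι] [MeasureSpace X]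
    [SigmaFinite (volume : Measure X)] (f : ι → X → ENNReal) (hf : ∀ i, Measurable (f i)) :
    ∫⁻ v : ι → X, ∏ i, f i (v i) = ∏ i, ∫⁻ t, f i t := by
  classical
  rcases isEmpty_or_nonempty (ι → X) with h | ⟨⟨x⟩⟩
  · obtain ⟨i, hi⟩ := isEmpty_pi.1 h
    rw [lintegral_of_isEmpty, Finset.prod_eq_zero (Finset.mem_univ i) (lintegral_of_isEmpty _ _)]
  · rw [volume_pi, lintegral_eq_lmarginal_univ x, lmarginal_prod _ _ hf]

/-- The weight `⟨x⟩^{-2β}`, as an extended nonnegative real. -/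
def japWeight (β x : ℝ) : ENNReal := ENNReal.ofReal ((1 + x ^ 2) ^ (-β))

theorem measurable_japWeight (β : ℝ) : Measurable (japWeight β) := by
  unfold japWeight; fun_prop

theorem lintegral_japWeight_ne_top {β : ℝ} (hβ : 1 / 2 < β) : ∫⁻ x, japWeight β x ≠ ⊤ := by
  have h := integrable_rpow_neg_one_add_norm_sq (E := ℝ) (μ := volume) (r := 2 * β)
    (by simp; linarith)
  have h2 := h.lintegral_lt_top
  refine ne_of_lt (lt_of_eq_of_lt ?_ h2)
  refine lintegral_congr fun x => ?_
  simp only [japWeight, Real.norm_eq_abs, sq_abs]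
  congr 2
  ring

theorem japWeight_le_tsum {β : ℝ} (hβ : 0 < β) (x : ℝ) :
    japWeight β x ≤ ∑' n : ℕ, ENNReal.ofReal (((4 : ℝ) ^ (-β))⁻¹ * ((4 : ℝ) ^ (-β)) ^ n) *
      (if |x| < 2 ^ n then 1 else 0) := by
  set r := (4 : ℝ) ^ (-β)
  have hr : 0 < r := by positivity
  have hr1 : r ≤ 1 := Real.rpow_le_one_of_one_le_of_nonpos (by norm_num) (by linarith)
  have hex : ∃ n : ℕ, |x| < 2 ^ n := pow_unbounded_of_one_lt |x| (by norm_num)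
  refine le_trans ?_ (ENNReal.le_tsum (Nat.find hex))
  rw [if_pos (Nat.find_spec hex), mul_one]
  refine ENNReal.ofReal_le_ofReal ?_
  rcases hn : Nat.find hex with _ | m
  · rw [pow_zero, mul_one]
    exact (Real.rpow_le_one_of_one_le_of_nonpos (le_add_of_nonneg_right (sq_nonneg x))
      (by linarith)).trans ((one_le_inv₀ hr).2 hr1)
  · have hm : (2 : ℝ) ^ m ≤ |x| := not_lt.1 (Nat.find_min hex (by omega))
    have h4 : (4 : ℝ) ^ m ≤ 1 + x ^ 2 := by
      rw [← sq_abs, show (4 : ℝ) = 2 ^ 2 by norm_num, ← pow_mul, mul_comm, pow_mul]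
      have : ((2 : ℝ) ^ m) ^ 2 ≤ |x| ^ 2 := by gcongr
      linarith
    calc (1 + x ^ 2) ^ (-β) ≤ ((4 : ℝ) ^ m) ^ (-β) :=
          Real.rpow_le_rpow_of_nonpos (by positivity) h4 (by linarith)
      _ = r ^ m := by
          rw [← Real.rpow_natCast, ← Real.rpow_mul (by norm_num), mul_comm,
            Real.rpow_mul (by norm_num), Real.rpow_natCast]
      _ = r⁻¹ * r ^ (m + 1) := by rw [pow_succ]; field_simp

theorem buildVec_eq_hypProj {k : ℕ} (B : Finset (Fin (k + 1))) (j₀ : Fin (k + 1))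
    (g : Fin (k + 1) → ℝ) (h : {j // j ∈ B.erase j₀} → ℝ) :
    buildVec k B j₀ g h = hypProj j₀ (Function.updateFinset g (B.erase j₀) h) := by
  rw [buildVec, completeAt_eq_hypProj]
  rfl

theorem measurable_buildVec {k : ℕ} (B : Finset (Fin (k + 1))) (j₀ : Fin (k + 1))
    (g : Fin (k + 1) → ℝ) : Measurable (buildVec k B j₀ g) := by
  have : MeasurableConstSMul ℤ ℝ := ⟨fun c => (continuous_const_smul c).measurable⟩
  have h := (measurable_hypProj (G := ℝ) j₀).comp
    (measurable_updateFinset (s := B.erase j₀) (x := g))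
  exact (funext fun y => (buildVec_eq_hypProj B j₀ g y).symm : _ = buildVec k B j₀ g) ▸ h

theorem measurable_PhiFull (k : ℕ) : Measurable (PhiFull k) := by
  unfold PhiFull; fun_prop

theorem measurable_tailVec (k : ℕ) : Measurable (tailVec k) := by
  unfold tailVec; fun_prop

/-- Summing a frequency-restricted estimate over dyadic scales. -/
theorem FreqRestricted.exists_lintegral_japWeight_le {k : ℕ} {M' : (Fin k → ℝ) → ℝ}
    {B : Finset (Fin (k + 1))} {C₀ θ β : ℝ} (hθ : 0 < θ) (hβ : θ < 2 * β)
    (hM : Measurable M') (hM0 : ∀ ξ, 0 ≤ M' ξ) (h : FreqRestricted k M' B C₀ θ) :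
    ∃ C : ENNReal, C ≠ ⊤ ∧ ∀ α : ℝ, ∀ j₀ ∈ B, ∀ g : Fin (k + 1) → ℝ,
      ∫⁻ y : {j // j ∈ B.erase j₀} → ℝ, ENNReal.ofReal (M' (tailVec k (buildVec k B j₀ g y))) *
        japWeight β (PhiFull k (buildVec k B j₀ g y) - α) ≤ C := by
  set r := (4 : ℝ) ^ (-β) with hr
  have hr0 : 0 < r := by positivity
  have hsum : Summable fun n : ℕ => r⁻¹ * C₀ * (r * 2 ^ θ) ^ n := by
    refine (summable_geometric_of_lt_one (by positivity) ?_).mul_left _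
    rw [hr, show (4 : ℝ) = 2 ^ (2 : ℝ) by norm_num, ← Real.rpow_mul (by norm_num),
      ← Real.rpow_add (by norm_num)]
    exact Real.rpow_lt_one_of_one_lt_of_neg (by norm_num) (by linarith)
  refine ⟨∑' n : ℕ, ENNReal.ofReal (r⁻¹ * C₀ * (r * 2 ^ θ) ^ n), hsum.tsum_ofReal_ne_top,
    fun α j₀ hj₀ g => ?_⟩
  have hb := measurable_buildVec B j₀ g
  have hP : Measurable fun y => |PhiFull k (buildVec k B j₀ g y) - α| :=
    (((measurable_PhiFull k).comp hb).sub_const α).abs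
  have hMb : Measurable fun y => M' (tailVec k (buildVec k B j₀ g y)) :=
    hM.comp ((measurable_tailVec k).comp hb)
  have hmeas : ∀ n : ℕ, Measurable fun y => ENNReal.ofReal
      (M' (tailVec k (buildVec k B j₀ g y)) *
        (if |PhiFull k (buildVec k B j₀ g y) - α| < 2 ^ n then 1 else 0)) := fun n =>
    (hMb.mul (Measurable.ite (measurableSet_lt hP measurable_const) measurable_const
      measurable_const)).ennreal_ofReal
  calc _ ≤ ∫⁻ y : {j // j ∈ B.erase j₀} → ℝ, ∑' n : ℕ, ENNReal.ofReal (r⁻¹ * r ^ n) *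
        ENNReal.ofReal (M' (tailVec k (buildVec k B j₀ g y)) *
          (if |PhiFull k (buildVec k B j₀ g y) - α| < 2 ^ n then 1 else 0)) := by
        refine lintegral_mono fun y => ?_
        refine (mul_le_mul_right (japWeight_le_tsum (by linarith) _) _).trans ?_
        rw [← ENNReal.tsum_mul_left]
        refine ENNReal.tsum_le_tsum fun n => ?_
        rw [ENNReal.ofReal_mul (hM0 _)]
        split_ifs <;> simp [mul_comm, hr]
    _ = ∑' n : ℕ, ENNReal.ofReal (r⁻¹ * r ^ n) * ∫⁻ y : {j // j ∈ B.erase j₀} → ℝ,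
        ENNReal.ofReal (M' (tailVec k (buildVec k B j₀ g y)) *
          (if |PhiFull k (buildVec k B j₀ g y) - α| < 2 ^ n then 1 else 0)) := by
        rw [lintegral_tsum fun n => ((hmeas n).const_mul _).aemeasurable]
        exact tsum_congr fun n => lintegral_const_mul _ (hmeas n)
    _ ≤ _ := by
        refine ENNReal.tsum_le_tsum fun n => ?_
        refine (mul_le_mul_right (h (2 ^ n) (by positivity) α j₀ hj₀ g) _).trans ?_
        rw [← ENNReal.ofReal_mul (by positivity)]
        refine le_of_eq (congrArg _ ?_)
        have e : ((2 : ℝ) ^ n) ^ θ = (2 ^ θ) ^ n := by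
          rw [← Real.rpow_natCast 2 n, ← Real.rpow_natCast (2 ^ θ) n,
            ← Real.rpow_mul (by norm_num), ← Real.rpow_mul (by norm_num), mul_comm]
        rw [e, mul_pow]
        ring

/-- The modulation `τ - ξ³`. -/
def modul (p : ℝ × ℝ) : ℝ := p.1 - p.2 ^ 3

theorem measurable_modul : Measurable modul := by
  unfold modul; fun_prop

theorem japWeight_eq_of_sq_eq {β x y : ℝ} (h : x ^ 2 = y ^ 2) :
    japWeight β x = japWeight β y := by
  rw [japWeight, japWeight, h]

/-- On the hyperplane the modulations sum up to the resonance function. -/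
theorem sum_hypSign_modul {k : ℕ} {v : Fin (k + 1) → ℝ × ℝ} (hv : hypForm v = 0) :
    ∑ j, (hypSign k j : ℝ) * modul (v j) = PhiFull k fun j => (v j).2 := by
  have h1 : -(v 0).1 + ∑ i : Fin k, (v i.succ).1 = 0 := by
    have := congrArg Prod.fst (hypForm_eq v)
    simpa [hv, Prod.fst_sum] using this.symm
  simp only [Fin.sum_univ_succ, hypSign, modul, PhiFull, Fin.cons_zero, Fin.cons_succ,
    Int.cast_neg, Int.cast_one, one_mul, Finset.sum_sub_distrib]
  linarith

theorem japWeight_modul_hypProj {k : ℕ} (β : ℝ) (j : Fin (k + 1)) (v : Fin (k + 1) → ℝ × ℝ) :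
    japWeight β (modul (hypProj j v j)) =
      japWeight β (PhiFull k (fun i => (hypProj j v i).2) -
        ∑ i ∈ Finset.univ.erase j, (hypSign k i : ℝ) * modul (v i)) := by
  refine japWeight_eq_of_sq_eq ?_
  rw [← sum_hypSign_modul (hypForm_hypProj j v), ← Finset.add_sum_erase _ _ (Finset.mem_univ j),
    Finset.sum_congr rfl (fun i hi => by rw [hypProj_of_ne (Finset.ne_of_mem_erase hi)]),
    add_sub_cancel_right, mul_pow, pow_two (hypSign k j : ℝ)]
  have := hypSign_mul_self k j
  rw [show (hypSign k j : ℝ) * hypSign k j = 1 by exact_mod_cast this, one_mul]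

/-- Change of variables from `(τ, ξ)` to `(τ - ξ³, ξ)` in several variables. -/
theorem lintegral_modul_change {ι : Type*} [Fintype ι] {F : (ι → ℝ × ℝ) → ENNReal}
    (hF : Measurable F) :
    ∫⁻ y, F y = ∫⁻ σ : ι → ℝ, ∫⁻ ξ : ι → ℝ, F fun i => (σ i + ξ i ^ 3, ξ i) := by
  let e := MeasurableEquiv.arrowProdEquivProdArrow ℝ ℝ ι
  have he : MeasurePreserving e.symm :=
    (volume_measurePreserving_arrowProdEquivProdArrow ℝ ℝ ι).symm
  have he' : ∀ p, e.symm p = fun i => (p.1 i, p.2 i) := fun p => rfl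
  have hm : Measurable fun p : (ι → ℝ) × (ι → ℝ) => F fun i => (p.1 i, p.2 i) :=
    hF.comp (by fun_prop)
  have hm' : Measurable fun p : (ι → ℝ) × (ι → ℝ) =>
      F fun i => (p.1 i + p.2 i ^ 3, p.2 i) := hF.comp (by fun_prop)
  rw [← he.lintegral_comp_emb e.symm.measurableEmbedding]
  simp only [he']
  rw [Measure.volume_eq_prod, lintegral_prod_symm' _ hm]
  rw [← lintegral_prod _ hm'.aemeasurable, lintegral_prod_symm' _ hm']
  refine lintegral_congr fun ξ => ?_
  exact (lintegral_add_right_eq_self (fun τ : ι → ℝ => F fun i => (τ i, ξ i))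
    (fun i => ξ i ^ 3)).symm

theorem measurable_weighted {k : ℕ} {N : (Fin (k + 1) → ℝ) → ENNReal} (hN : Measurable N)
    (β : Fin (k + 1) → ℝ) (B : Finset (Fin (k + 1))) :
    Measurable fun w : Fin (k + 1) → ℝ × ℝ => N (fun j => (w j).2) *
      ∏ j ∈ B, japWeight (β j) (modul (w j)) := by
  refine Measurable.mul (hN.comp (by fun_prop)) (Finset.measurable_fun_prod _ fun j _ => ?_)
  exact (measurable_japWeight _).comp (measurable_modul.comp (measurable_pi_apply j))

theorem lmarginal_restricted_le {k : ℕ} {B : Finset (Fin (k + 1))} {j₀ : Fin (k + 1)}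
    (hj₀ : j₀ ∈ B) {N : (Fin (k + 1) → ℝ) → ENNReal} (hN : Measurable N)
    (β : Fin (k + 1) → ℝ) {C : ENNReal}
    (h : ∀ α : ℝ, ∀ g : Fin (k + 1) → ℝ, ∫⁻ y : {j // j ∈ B.erase j₀} → ℝ,
      N (buildVec k B j₀ g y) * japWeight (β j₀) (PhiFull k (buildVec k B j₀ g y) - α) ≤ C)
    (x : Fin (k + 1) → ℝ × ℝ) :
    lmarginal (fun _ => volume) (B.erase j₀) (fun v => N (fun j => (hypProj j₀ v j).2) *
      ∏ j ∈ B, japWeight (β j) (modul (hypProj j₀ v j))) x ≤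
    C * ∏ j ∈ B.erase j₀, ∫⁻ t, japWeight (β j) t := by
  have hp := measurable_hypProj_prod (k := k) j₀
  have hmeas : Measurable fun v : Fin (k + 1) → ℝ × ℝ => N (fun j => (hypProj j₀ v j).2) *
      ∏ j ∈ B, japWeight (β j) (modul (hypProj j₀ v j)) :=
    (measurable_weighted hN β B).comp hp
  rw [lmarginal]
  have hmeas' : Measurable fun y : B.erase j₀ → ℝ × ℝ =>
      N (fun j => (hypProj j₀ (Function.updateFinset x (B.erase j₀) y) j).2) *
      ∏ j ∈ B, japWeight (β j)
        (modul (hypProj j₀ (Function.updateFinset x (B.erase j₀) y) j)) :=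
    hmeas.comp measurable_updateFinset
  have hcv := lintegral_modul_change hmeas'
  rw [volume_pi] at hcv
  rw [hcv]
  have hup : ∀ σ ξ : B.erase j₀ → ℝ,
      (fun j => (Function.updateFinset x (B.erase j₀) (fun i => (σ i + ξ i ^ 3, ξ i)) j).2) =
        Function.updateFinset (fun j => (x j).2) (B.erase j₀) ξ := fun σ ξ => by
    ext j; simp only [Function.updateFinset]; split_ifs <;> rfl
  have hmod : ∀ σ ξ : B.erase j₀ → ℝ, ∀ j,
      modul (Function.updateFinset x (B.erase j₀) (fun i => (σ i + ξ i ^ 3, ξ i)) j) =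
        Function.updateFinset (fun j => modul (x j)) (B.erase j₀) σ j := fun σ ξ j => by
    simp only [Function.updateFinset]; split_ifs <;> simp [modul]
  have key : ∀ σ ξ : B.erase j₀ → ℝ,
      N (fun j => (hypProj j₀ (Function.updateFinset x (B.erase j₀)
        (fun i => (σ i + ξ i ^ 3, ξ i))) j).2) *
      ∏ j ∈ B, japWeight (β j) (modul (hypProj j₀ (Function.updateFinset x (B.erase j₀)
        (fun i => (σ i + ξ i ^ 3, ξ i))) j)) =
      (N (buildVec k B j₀ (fun j => (x j).2) ξ) * japWeight (β j₀)
        (PhiFull k (buildVec k B j₀ (fun j => (x j).2) ξ) -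
          ∑ i ∈ Finset.univ.erase j₀, (hypSign k i : ℝ) *
            Function.updateFinset (fun j => modul (x j)) (B.erase j₀) σ i)) *
      ∏ j : B.erase j₀, japWeight (β j) (σ j) := fun σ ξ => by
    have h1 : (fun j => (hypProj j₀ (Function.updateFinset x (B.erase j₀)
        (fun i => (σ i + ξ i ^ 3, ξ i))) j).2) = buildVec k B j₀ (fun j => (x j).2) ξ := by
      ext j
      rw [hypProj_snd, hup, buildVec_eq_hypProj]
    rw [← Finset.mul_prod_erase _ _ hj₀, japWeight_modul_hypProj, h1]
    simp_rw [hmod]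
    rw [mul_assoc]
    congr 2
    rw [← Finset.prod_coe_sort]
    refine Finset.prod_congr rfl fun j _ => ?_
    rw [hypProj_of_ne (Finset.ne_of_mem_erase j.2), hmod]
    simp [Function.updateFinset]
  simp_rw [key]
  have hb := measurable_buildVec B j₀ (fun j => (x j).2)
  calc _ ≤ ∫⁻ σ : B.erase j₀ → ℝ, C * ∏ j : B.erase j₀, japWeight (β j) (σ j) := by
        refine lintegral_mono fun σ => ?_
        dsimp only
        rw [lintegral_mul_const]
        · exact mul_le_mul_left (h _ _) _
        · exact (hN.comp hb).mul ((measurable_japWeight _).comp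
            (((measurable_PhiFull k).comp hb).sub_const _))
    _ = _ := by
        rw [lintegral_const_mul, lintegral_pi_prod (fun j : B.erase j₀ => japWeight (β j))
          fun _ => measurable_japWeight _, Finset.prod_coe_sort (B.erase j₀)
            (fun j => ∫⁻ t, japWeight (β j) t)]
        exact Finset.measurable_fun_prod _ fun j _ =>
          (measurable_japWeight _).comp (measurable_pi_apply j)

/-- The integrand obtained after Cauchy-Schwarz: the variables in `B` carry weights in the
modulation, the variables in `S \ B` carry arbitrary functions. -/
def splitIntegrand {k : ℕ} (N : (Fin (k + 1) → ℝ) → ENNReal) (β : Fin (k + 1) → ℝ)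
    (f : Fin (k + 1) → ℝ × ℝ → ENNReal) (B S : Finset (Fin (k + 1)))
    (w : Fin (k + 1) → ℝ × ℝ) : ENNReal :=
  (N (fun j => (w j).2) * ∏ j ∈ B, japWeight (β j) (modul (w j))) * ∏ j ∈ S \ B, f j (w j)

theorem measurable_splitIntegrand {k : ℕ} {N : (Fin (k + 1) → ℝ) → ENNReal}
    (hN : Measurable N) (β : Fin (k + 1) → ℝ) {f : Fin (k + 1) → ℝ × ℝ → ENNReal}
    (hf : ∀ j, Measurable (f j)) (B S : Finset (Fin (k + 1))) :
    Measurable (splitIntegrand N β f B S) :=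
  (measurable_weighted hN β B).mul
    (Finset.measurable_fun_prod _ fun j _ => (hf j).comp (measurable_pi_apply j))

theorem lmarginal_splitIntegrand_le {k : ℕ} {B S : Finset (Fin (k + 1))} (hBS : B ⊆ S)
    {j₀ i₀ : Fin (k + 1)} (hj₀ : j₀ ∈ B) (hi₀ : i₀ ∈ S)
    {N : (Fin (k + 1) → ℝ) → ENNReal} (hN : Measurable N)
    (β : Fin (k + 1) → ℝ) {C : ENNReal}
    (h : ∀ α : ℝ, ∀ g : Fin (k + 1) → ℝ, ∫⁻ y : {j // j ∈ B.erase j₀} → ℝ,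
      N (buildVec k B j₀ g y) * japWeight (β j₀) (PhiFull k (buildVec k B j₀ g y) - α) ≤ C)
    (f : Fin (k + 1) → ℝ × ℝ → ENNReal) (hf : ∀ j, Measurable (f j))
    (x : Fin (k + 1) → ℝ × ℝ) :
    lmarginal (fun _ => volume) (S.erase i₀)
      (fun v => splitIntegrand N β f B S (hypProj i₀ v)) x ≤
    (C * ∏ j ∈ B.erase j₀, ∫⁻ t, japWeight (β j) t) * ∏ j ∈ S \ B, ∫⁻ p, f j p := by
  have hm1 := measurable_weighted hN β B
  have hm2 : Measurable fun w : Fin (k + 1) → ℝ × ℝ => ∏ j ∈ S \ B, f j (w j) :=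
    Finset.measurable_fun_prod _ fun j _ => (hf j).comp (measurable_pi_apply j)
  have hm := measurable_splitIntegrand hN β hf B S
  rw [lmarginal_hypProj_eq S hi₀ (hBS hj₀) hm]
  have hS : S.erase j₀ = (S \ B) ∪ B.erase j₀ := by
    ext i
    simp only [Finset.mem_erase, Finset.mem_union, Finset.mem_sdiff]
    constructor
    · rintro ⟨h1, h2⟩
      by_cases h3 : i ∈ B
      · exact Or.inr ⟨h1, h3⟩
      · exact Or.inl ⟨h2, h3⟩
    · rintro (⟨h1, h2⟩ | ⟨h1, h2⟩)
      · exact ⟨fun e => h2 (e ▸ hj₀), h1⟩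
      · exact ⟨h1, hBS h2⟩
  have hdisj : Disjoint (S \ B) (B.erase j₀) :=
    Finset.sdiff_disjoint.mono_right (Finset.erase_subset _ _)
  have hmp : Measurable fun v => splitIntegrand N β f B S (hypProj j₀ v) :=
    hm.comp (measurable_hypProj_prod j₀)
  rw [hS, lmarginal_union _ _ hmp hdisj]
  rw [← lmarginal_prod (S \ B) f hf x]
  have hconst : ∀ y, Measurable fun y' : ↥(S \ B) → ℝ × ℝ =>
      ∏ j ∈ S \ B, f j (Function.updateFinset y (S \ B) y' j) := fun y =>
    hm2.comp measurable_updateFinset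
  simp only [lmarginal, splitIntegrand]
  rw [← lintegral_const_mul _ (hconst x)]
  refine lintegral_mono fun y => ?_
  dsimp only
  set z := Function.updateFinset x (S \ B) y
  have hz : ∀ y' : ↥(B.erase j₀) → ℝ × ℝ,
      ∏ j ∈ S \ B, f j (hypProj j₀ (Function.updateFinset z (B.erase j₀) y') j) =
        ∏ j ∈ S \ B, f j (z j) := fun y' => by
    refine Finset.prod_congr rfl fun j hj => ?_
    have hjB := (Finset.mem_sdiff.1 hj).2
    have hne : j ≠ j₀ := fun e => hjB (e ▸ hj₀)
    rw [hypProj_of_ne hne, Function.updateFinset,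
      dif_neg (fun hh => hjB (Finset.mem_of_mem_erase hh))]
  simp_rw [hz]
  rw [lintegral_mul_const]
  · exact mul_le_mul_left (lmarginal_restricted_le hj₀ hN β h z) _
  · exact (hm1.comp (measurable_hypProj_prod j₀)).comp measurable_updateFinset

theorem sq_lintegral_le_mul {α : Type*} [MeasurableSpace α] {μ : Measure α}
    {G P Q : α → ENNReal} (hP : Measurable P) (hQ : Measurable Q)
    (h : ∀ a, G a ^ 2 ≤ P a * Q a) : (∫⁻ a, G a ∂μ) ^ 2 ≤ (∫⁻ a, P a ∂μ) * ∫⁻ a, Q a ∂μ := by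
  have hsq : ∀ t : ENNReal, (t ^ (1 / 2 : ℝ)) ^ (2 : ℝ) = t := fun t => by
    rw [← ENNReal.rpow_mul]; norm_num
  have hG : ∀ a, G a ≤ P a ^ (1 / 2 : ℝ) * Q a ^ (1 / 2 : ℝ) := fun a => by
    rw [← ENNReal.mul_rpow_of_nonneg _ _ (by norm_num),
      ← ENNReal.rpow_le_rpow_iff (z := 2) (by norm_num), hsq]
    simpa using h a
  have hcs := ENNReal.lintegral_mul_le_Lp_mul_Lq μ Real.HolderConjugate.two_two
    (hP.pow_const (1 / 2 : ℝ)).aemeasurable (hQ.pow_const (1 / 2 : ℝ)).aemeasurable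
  simp only [hsq] at hcs
  calc (∫⁻ a, G a ∂μ) ^ 2
      ≤ ((∫⁻ a, P a ∂μ) ^ (1 / 2 : ℝ) * (∫⁻ a, Q a ∂μ) ^ (1 / 2 : ℝ)) ^ 2 := by
        gcongr
        exact (lintegral_mono hG).trans hcs
    _ = _ := by
        rw [← ENNReal.rpow_natCast, Nat.cast_ofNat, ENNReal.mul_rpow_of_nonneg _ _ (by norm_num),
          hsq, hsq]

/-- The complements of `A` and of `Aᶜ` among the indices cover each nonzero index once. -/
theorem prod_sdiff_mul_prod_sdiff_compl {k : ℕ} {A : Finset (Fin (k + 1))} (h0 : 0 ∈ A)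
    (g : Fin (k + 1) → ENNReal) :
    (∏ j ∈ Finset.univ \ A, g j) * ∏ j ∈ Finset.univ.erase 0 \ Aᶜ, g j =
      ∏ i : Fin k, g i.succ := by
  have hdis : Disjoint (Finset.univ \ A) (Finset.univ.erase 0 \ Aᶜ) := by
    rw [Finset.disjoint_left]
    intro j h1 h2
    simp_all
  have hun : (Finset.univ \ A) ∪ (Finset.univ.erase 0 \ Aᶜ) =
      (Finset.univ : Finset (Fin k)).map (Fin.succEmb k) := by
    ext j
    refine Fin.cases ?_ (fun i => ?_) j
    · simp [h0]
    · simp [em']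
  rw [← Finset.prod_union hdis, hun, Finset.prod_map]
  rfl

/-- The multilinear estimate in the form of iterated integrals over the hyperplane. -/
theorem lintegral_sq_lmarginal_le {k : ℕ} {A : Finset (Fin (k + 1))} (h0 : 0 ∈ A)
    {j₁ i₀ : Fin (k + 1)} (hj₁ : j₁ ∉ A) (hi₀ : i₀ ≠ 0)
    {N₁ N₂ : (Fin (k + 1) → ℝ) → ENNReal} (hN₁ : Measurable N₁) (hN₂ : Measurable N₂)
    (β : Fin (k + 1) → ℝ) {C₁ C₂ : ENNReal}
    (h₁ : ∀ α : ℝ, ∀ g : Fin (k + 1) → ℝ, ∫⁻ y : {j // j ∈ A.erase 0} → ℝ,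
      N₁ (buildVec k A 0 g y) * japWeight (β 0) (PhiFull k (buildVec k A 0 g y) - α) ≤ C₁)
    (h₂ : ∀ α : ℝ, ∀ g : Fin (k + 1) → ℝ, ∫⁻ y : {j // j ∈ Aᶜ.erase j₁} → ℝ,
      N₂ (buildVec k Aᶜ j₁ g y) *
        japWeight (β j₁) (PhiFull k (buildVec k Aᶜ j₁ g y) - α) ≤ C₂)
    (f : Fin (k + 1) → ℝ × ℝ → ENNReal) (hf : ∀ j, Measurable (f j))
    {w : ℝ × ℝ → ENNReal} {F : (Fin (k + 1) → ℝ × ℝ) → ENNReal} (hF : Measurable F)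
    (hFw : ∀ v, hypForm v = 0 → w (v 0) * F v ^ 2 ≤ splitIntegrand N₁ β f A Finset.univ v *
      splitIntegrand N₂ β f Aᶜ (Finset.univ.erase 0) v) (x : Fin (k + 1) → ℝ × ℝ) :
    ∫⁻ q, w q * (lmarginal (fun _ => volume) ((Finset.univ.erase 0).erase i₀)
      (fun v => F (hypProj i₀ v)) (Function.update x 0 q)) ^ 2 ≤
    (C₁ * ∏ j ∈ A.erase 0, ∫⁻ t, japWeight (β j) t) *
      (C₂ * ∏ j ∈ Aᶜ.erase j₁, ∫⁻ t, japWeight (β j) t) *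
      ∏ i : Fin k, ∫⁻ p, f i.succ p := by
  set s := (Finset.univ.erase (0 : Fin (k + 1))).erase i₀ with hs
  set P := splitIntegrand N₁ β f A Finset.univ
  set Q := splitIntegrand N₂ β f Aᶜ (Finset.univ.erase 0)
  have hp := measurable_hypProj_prod (k := k) i₀
  have hP : Measurable fun v => P (hypProj i₀ v) :=
    (measurable_splitIntegrand hN₁ β hf A Finset.univ).comp hp
  have hQ : Measurable fun v => Q (hypProj i₀ v) :=
    (measurable_splitIntegrand hN₂ β hf Aᶜ (Finset.univ.erase 0)).comp hp
  have hFp : Measurable fun v => F (hypProj i₀ v) := hF.comp hp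
  have hAc : Aᶜ ⊆ Finset.univ.erase (0 : Fin (k + 1)) := fun j hj =>
    Finset.mem_erase.2 ⟨fun e => Finset.mem_compl.1 hj (e ▸ h0), Finset.mem_univ j⟩
  have hQle := lmarginal_splitIntegrand_le hAc (Finset.mem_compl.2 hj₁)
    (Finset.mem_erase.2 ⟨hi₀, Finset.mem_univ i₀⟩) hN₂ β h₂ f hf
  have hPle := lmarginal_splitIntegrand_le (Finset.subset_univ A) h0 (Finset.mem_univ i₀)
    hN₁ β h₁ f hf
  set K₁ := C₁ * ∏ j ∈ A.erase 0, ∫⁻ t, japWeight (β j) t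
  set K₂ := C₂ * ∏ j ∈ Aᶜ.erase j₁, ∫⁻ t, japWeight (β j) t
  have hpt : ∀ y : Fin (k + 1) → ℝ × ℝ,
      w (y 0) * (lmarginal (fun _ => volume) s (fun v => F (hypProj i₀ v)) y) ^ 2 ≤
        lmarginal (fun _ => volume) s (fun v => P (hypProj i₀ v)) y *
        lmarginal (fun _ => volume) s (fun v => Q (hypProj i₀ v)) y := fun y => by
    have hsq : w (y 0) = (w (y 0) ^ (1 / 2 : ℝ)) ^ 2 := by
      rw [← ENNReal.rpow_natCast, ← ENNReal.rpow_mul]; norm_num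
    have hFu : Measurable fun z : s → ℝ × ℝ =>
      F (hypProj i₀ (Function.updateFinset y s z)) := hFp.comp measurable_updateFinset
    rw [hsq, ← mul_pow]
    simp only [lmarginal]
    rw [← lintegral_const_mul _ hFu]
    refine sq_lintegral_le_mul (hP.comp measurable_updateFinset)
      (hQ.comp measurable_updateFinset) fun z => ?_
    rw [mul_pow, ← hsq]
    have hz : hypProj i₀ (Function.updateFinset y s z) 0 = y 0 := by
      rw [hypProj_of_ne (Ne.symm hi₀), Function.updateFinset, dif_neg (by simp [s])]
    have := hFw _ (hypForm_hypProj i₀ (Function.updateFinset y s z))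
    rwa [hz] at this
  have hmP : Measurable fun q => lmarginal (fun _ => volume) s
      (fun v => P (hypProj i₀ v)) (Function.update x 0 q) :=
    (Measurable.lmarginal (fun _ => volume) hP).comp (measurable_update x)
  have h0s : (0 : Fin (k + 1)) ∉ s := by simp [s]
  have hins : insert 0 s = Finset.univ.erase i₀ := by
    rw [hs, Finset.erase_right_comm, Finset.insert_erase]
    exact Finset.mem_erase.2 ⟨Ne.symm hi₀, Finset.mem_univ _⟩
  calc _ ≤ ∫⁻ q, lmarginal (fun _ => volume) s (fun v => P (hypProj i₀ v))
        (Function.update x 0 q) * (K₂ * ∏ j ∈ Finset.univ.erase 0 \ Aᶜ, ∫⁻ p, f j p) := by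
        refine lintegral_mono fun q => ?_
        have := hpt (Function.update x 0 q)
        rw [Function.update_self] at this
        exact this.trans (mul_le_mul_right (hQle _) _)
    _ = lmarginal (fun _ => volume) (Finset.univ.erase i₀) (fun v => P (hypProj i₀ v)) x *
        (K₂ * ∏ j ∈ Finset.univ.erase 0 \ Aᶜ, ∫⁻ p, f j p) := by
        rw [lintegral_mul_const _ hmP, ← hins, lmarginal_insert _ hP h0s]
    _ ≤ (K₁ * ∏ j ∈ Finset.univ \ A, ∫⁻ p, f j p) *
        (K₂ * ∏ j ∈ Finset.univ.erase 0 \ Aᶜ, ∫⁻ p, f j p) := mul_le_mul_left (hPle x) _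
    _ = _ := by
        rw [← prod_sdiff_mul_prod_sdiff_compl h0 fun j => ∫⁻ p, f j p]
        ring

theorem hypProj_last_succ {m : ℕ} (w : Fin (m + 2) → ℝ) (j : Fin (m + 1)) :
    hypProj (Fin.last (m + 1)) w j.succ =
      padTot (m + 1) (w 0) (fun i : Fin m => w i.castSucc.succ) j := by
  refine Fin.lastCases ?_ (fun i => ?_) j
  · have hs : hypSign (m + 1) (Fin.last (m + 1)) = 1 := by
      rw [← Fin.succ_last, hypSign, Fin.cons_succ]
    rw [Fin.succ_last, hypProj, Function.update_self, hypForm_eq, hs, Fin.sum_univ_castSucc]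
    simp only [padTot, Fin.val_last, add_tsub_cancel_right, lt_irrefl, dite_false, one_smul,
      Fin.succ_last]
    refine Eq.trans ?_ (show w 0 - ∑ i : Fin m, w i.castSucc.succ = _ from rfl)
    ring
  · rw [hypProj_of_ne (by rw [← Fin.succ_last]; simp [Fin.ext_iff, i.isLt.ne])]
    simp [padTot]

/-- The absolute value of the integrand of `convFT`, as a function of all the space-time
frequencies. -/
def convIntegrand {k : ℕ} (M : (Fin k → ℝ) → ℝ) (u : Fin k → ℝ × ℝ → ℂ)
    (w : Fin (k + 1) → ℝ × ℝ) : ENNReal :=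
  ENNReal.ofReal (M (tailVec k fun j => (w j).2)) *
    ∏ j, ‖FT2 (u j) (w j.succ).1 (w j.succ).2‖ₑ

theorem measurable_convIntegrand {k : ℕ} {M : (Fin k → ℝ) → ℝ} (hM : Measurable M)
    {u : Fin k → ℝ × ℝ → ℂ} (hu : ∀ j, Measurable fun p : ℝ × ℝ => FT2 (u j) p.1 p.2) :
    Measurable (convIntegrand M u) := by
  refine ((hM.comp ((measurable_tailVec k).comp (by fun_prop))).ennreal_ofReal).mul
    (Finset.measurable_fun_prod _ fun j _ => ?_)
  exact ((hu j).comp (measurable_pi_apply j.succ)).enorm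

theorem enorm_convFT_le {m : ℕ} {M : (Fin (m + 1) → ℝ) → ℝ} (hM : Measurable M)
    (hM0 : ∀ ξ, 0 ≤ M ξ) {u : Fin (m + 1) → ℝ × ℝ → ℂ}
    (hu : ∀ j, Measurable fun p : ℝ × ℝ => FT2 (u j) p.1 p.2) (x : Fin (m + 2) → ℝ × ℝ) :
    ‖convFT (m + 1) (fun ξ => (M ξ : ℂ)) u (x 0).1 (x 0).2‖ₑ ≤
      lmarginal (fun _ => volume) ((Finset.univ.erase 0).erase (Fin.last (m + 1)))
        (fun v => convIntegrand M u (hypProj (Fin.last (m + 1)) v)) x := by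
  set e : Fin m → Fin (m + 2) := fun i => i.castSucc.succ
  have he : Function.Injective e := (Fin.succ_injective _).comp (Fin.castSucc_injective _)
  have himg : Finset.univ.image e = (Finset.univ.erase 0).erase (Fin.last (m + 1)) := by
    ext j
    refine Fin.cases ?_ (fun i => ?_) j
    · simp [e]
    · refine Fin.lastCases ?_ (fun i => ?_) i
      · simp [e]
      · simp [e, Fin.ext_iff, i.isLt.ne]
  set f : (Fin m → ℝ × ℝ) → ENNReal := fun p => convIntegrand M u
    (hypProj (Fin.last (m + 1)) (Fin.cons (x 0) (Fin.snoc p 0 : Fin (m + 1) → ℝ × ℝ)))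
  have hf : Measurable f := by
    refine ((measurable_convIntegrand hM hu).comp (measurable_hypProj_prod _)).comp ?_
    refine measurable_pi_iff.2 fun j => ?_
    refine Fin.cases ?_ (fun i => ?_) j
    · simp
    · refine Fin.lastCases ?_ (fun i => ?_) i
      · simp
      · simpa using measurable_pi_apply i
  have hval : ∀ w : Fin (m + 2) → ℝ × ℝ, w 0 = x 0 →
      convIntegrand M u (hypProj (Fin.last (m + 1)) w) =
      ‖(M (padTot (m + 1) (x 0).2 fun i : Fin m => (w (e i)).2) : ℂ) *
        ∏ j, FT2 (u j) (padTot (m + 1) (x 0).1 (fun i : Fin m => (w (e i)).1) j)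
          (padTot (m + 1) (x 0).2 (fun i : Fin m => (w (e i)).2) j)‖ₑ := fun w hw => by
    have h2 : (tailVec (m + 1) fun j => (hypProj (Fin.last (m + 1)) w j).2) =
        padTot (m + 1) (x 0).2 fun i : Fin m => (w (e i)).2 := by
      ext j
      rw [tailVec, hypProj_snd, hypProj_last_succ, hw]
    simp only [convIntegrand, h2, ← ofReal_norm, norm_mul, norm_prod, Complex.norm_real]
    rw [ENNReal.ofReal_mul (norm_nonneg _), ENNReal.ofReal_prod_of_nonneg
      fun _ _ => norm_nonneg _, Real.norm_of_nonneg (hM0 _)]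
    simp only [hypProj_fst, hypProj_snd, hypProj_last_succ, hw, e]
  have h1 : lmarginal (fun _ => volume) ((Finset.univ.erase 0).erase (Fin.last (m + 1)))
      (fun v => convIntegrand M u (hypProj (Fin.last (m + 1)) v)) x = ∫⁻ p, f p := by
    have himage := lmarginal_image (μ := fun _ : Fin (m + 2) => (volume : Measure (ℝ × ℝ))) he
      Finset.univ hf x
    rw [himg, lmarginal_univ] at himage
    refine Eq.trans ?_ himage
    refine lintegral_congr fun y => ?_
    have h0 : Function.updateFinset x ((Finset.univ.erase 0).erase (Fin.last (m + 1))) y 0 =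
        x 0 := by simp [Function.updateFinset]
    dsimp only [Function.comp_apply, f]
    rw [hval _ h0, hval _ (Fin.cons_zero _ _)]
    simp [e]
  rw [h1]
  refine (enorm_integral_le_lintegral_enorm _).trans (lintegral_mono fun p => ?_)
  refine ((hval _ (Fin.cons_zero _ _)).trans ?_).ge
  simp [e]

theorem ofReal_wgt (s b : ℝ) (p : ℝ × ℝ) : ENNReal.ofReal (wgt s b p.1 p.2) =
    ENNReal.ofReal ((1 + p.2 ^ 2) ^ s) * japWeight (-b) (modul p) := by
  rw [wgt, ENNReal.ofReal_mul (by positivity), japWeight, modul, neg_neg]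

theorem japWeight_mul_ofReal_wgt (s b : ℝ) (p : ℝ × ℝ) :
    japWeight b (modul p) * ENNReal.ofReal (wgt s b p.1 p.2) =
      ENNReal.ofReal ((1 + p.2 ^ 2) ^ s) := by
  have h : 0 < 1 + modul p ^ 2 := by positivity
  rw [japWeight, ← ENNReal.ofReal_mul (by positivity), wgt, ← modul, mul_left_comm,
    ← Real.rpow_add h, neg_add_cancel, Real.rpow_zero, mul_one]

/-- The density of the squared Bourgain norm of `u`. -/
def bourgainDensity (s b : ℝ) (u : ℝ × ℝ → ℂ) (p : ℝ × ℝ) : ENNReal :=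
  ENNReal.ofReal (wgt s b p.1 p.2) * ‖FT2 u p.1 p.2‖ₑ ^ 2

theorem weight_sq_eq {k : ℕ} {s : ℝ} {sv : Fin k → ℝ} {M M₁ M₂ : (Fin k → ℝ) → ℝ}
    (hM₁ : ∀ ξ, 0 ≤ M₁ ξ) (hM₂ : ∀ ξ, 0 ≤ M₂ ξ) (hfact : ∀ ξ : Fin k → ℝ,
      Real.sqrt (M₁ ξ * M₂ ξ) =
        M ξ * (1 + (∑ j, ξ j) ^ 2) ^ (s / 2) / ∏ j, (1 + (ξ j) ^ 2) ^ (sv j / 2))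
    (ξ : Fin k → ℝ) : (1 + (∑ j, ξ j) ^ 2) ^ s * M ξ ^ 2 =
      M₁ ξ * M₂ ξ * ∏ j, (1 + ξ j ^ 2) ^ sv j := by
  have hsq : ∀ x t : ℝ, ((1 + x ^ 2) ^ (t / 2)) ^ 2 = (1 + x ^ 2) ^ t := fun x t => by
    rw [← Real.rpow_natCast, ← Real.rpow_mul (by positivity)]
    norm_num
  have hpos : 0 < ∏ j, (1 + ξ j ^ 2) ^ sv j := Finset.prod_pos fun j _ => by positivity
  have h := congrArg (· ^ 2) (hfact ξ)
  simp only [Real.sq_sqrt (mul_nonneg (hM₁ ξ) (hM₂ ξ)), div_pow, mul_pow, hsq,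
    ← Finset.prod_pow] at h
  rw [h]
  field_simp

/-- The weights of the Bourgain norms turn the square of the integrand into the product of the two
integrands governed by the frequency-restricted bounds. -/
theorem wgt_mul_convIntegrand_sq {k : ℕ} {s b b' : ℝ} {sv : Fin k → ℝ}
    {M M₁ M₂ : (Fin k → ℝ) → ℝ} (hM : ∀ ξ, 0 ≤ M ξ) (hM₁ : ∀ ξ, 0 ≤ M₁ ξ) (hM₂ : ∀ ξ, 0 ≤ M₂ ξ)
    (hfact : ∀ ξ : Fin k → ℝ, Real.sqrt (M₁ ξ * M₂ ξ) =
        M ξ * (1 + (∑ j, ξ j) ^ 2) ^ (s / 2) / ∏ j, (1 + (ξ j) ^ 2) ^ (sv j / 2))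
    {A : Finset (Fin (k + 1))} (h0 : 0 ∈ A) (u : Fin k → ℝ × ℝ → ℂ)
    {v : Fin (k + 1) → ℝ × ℝ} (hv : hypForm v = 0) :
    ENNReal.ofReal (wgt s b' (v 0).1 (v 0).2) * convIntegrand M u v ^ 2 =
      splitIntegrand (fun η => ENNReal.ofReal (M₁ (tailVec k η))) (Fin.cons (-b') fun _ => b)
        (Fin.cons 0 fun i => bourgainDensity (sv i) b (u i)) A Finset.univ v *
      splitIntegrand (fun η => ENNReal.ofReal (M₂ (tailVec k η))) (Fin.cons (-b') fun _ => b)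
        (Fin.cons 0 fun i => bourgainDensity (sv i) b (u i)) Aᶜ (Finset.univ.erase 0) v := by
  set β : Fin (k + 1) → ℝ := Fin.cons (-b') fun _ => b with hβ
  set f : Fin (k + 1) → ℝ × ℝ → ENNReal :=
    Fin.cons 0 fun i => bourgainDensity (sv i) b (u i) with hf
  set ξ : Fin k → ℝ := tailVec k fun j => (v j).2 with hξ
  have hsum : (v 0).2 = ∑ j, ξ j := by
    have := congrArg Prod.snd (hypForm_eq v)
    rw [hv] at this
    simp only [Prod.snd_zero, Prod.snd_add, Prod.snd_neg, Prod.snd_sum] at this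
    simp only [hξ, tailVec]
    linarith
  have hJ : (∏ j ∈ A, japWeight (β j) (modul (v j))) * ∏ j ∈ Aᶜ, japWeight (β j) (modul (v j)) =
      japWeight (-b') (modul (v 0)) * ∏ i : Fin k, japWeight b (modul (v i.succ)) := by
    rw [Finset.prod_mul_prod_compl, Fin.prod_univ_succ]
    simp [hβ]
  have hD := prod_sdiff_mul_prod_sdiff_compl h0 fun j => f j (v j)
  have hW : ENNReal.ofReal ((1 + (v 0).2 ^ 2) ^ s) * ENNReal.ofReal (M ξ) ^ 2 =
      ENNReal.ofReal (M₁ ξ) * ENNReal.ofReal (M₂ ξ) *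
        ∏ i, ENNReal.ofReal ((1 + ξ i ^ 2) ^ sv i) := by
    rw [← ENNReal.ofReal_prod_of_nonneg fun i _ => by positivity, ← ENNReal.ofReal_mul (hM₁ ξ),
      ← ENNReal.ofReal_mul (mul_nonneg (hM₁ ξ) (hM₂ ξ)), ← weight_sq_eq hM₁ hM₂ hfact,
      ← ENNReal.ofReal_pow (hM ξ), ← ENNReal.ofReal_mul (by positivity), hsum]
  have hE : (∏ i : Fin k, japWeight b (modul (v i.succ))) * ∏ i : Fin k, f i.succ (v i.succ) =
      (∏ i, ENNReal.ofReal ((1 + ξ i ^ 2) ^ sv i)) *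
        (∏ i, ‖FT2 (u i) (v i.succ).1 (v i.succ).2‖ₑ) ^ 2 := by
    rw [← Finset.prod_pow, ← Finset.prod_mul_distrib, ← Finset.prod_mul_distrib]
    refine Finset.prod_congr rfl fun i _ => ?_
    rw [hf, Fin.cons_succ, bourgainDensity, ← mul_assoc, japWeight_mul_ofReal_wgt]
    rfl
  calc _ = ENNReal.ofReal ((1 + (v 0).2 ^ 2) ^ s) * ENNReal.ofReal (M ξ) ^ 2 *
        japWeight (-b') (modul (v 0)) *
        (∏ i, ‖FT2 (u i) (v i.succ).1 (v i.succ).2‖ₑ) ^ 2 := by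
        rw [ofReal_wgt, convIntegrand]
        ring
    _ = ENNReal.ofReal (M₁ ξ) * ENNReal.ofReal (M₂ ξ) * japWeight (-b') (modul (v 0)) *
        ((∏ i, ENNReal.ofReal ((1 + ξ i ^ 2) ^ sv i)) *
          (∏ i, ‖FT2 (u i) (v i.succ).1 (v i.succ).2‖ₑ) ^ 2) := by
        rw [hW]
        ring
    _ = ENNReal.ofReal (M₁ ξ) * ENNReal.ofReal (M₂ ξ) *
        ((∏ j ∈ A, japWeight (β j) (modul (v j))) *
          ∏ j ∈ Aᶜ, japWeight (β j) (modul (v j))) *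
        ((∏ j ∈ Finset.univ \ A, f j (v j)) * ∏ j ∈ Finset.univ.erase 0 \ Aᶜ, f j (v j)) := by
        rw [← hE, hJ, hD]
        ring
    _ = _ := by
        rw [splitIntegrand, splitIntegrand]
        ring

theorem measurable_FT2 (u : SchwartzMap (ℝ × ℝ) ℂ) :
    Measurable fun p : ℝ × ℝ => FT2 u p.1 p.2 := by
  obtain ⟨U, hU⟩ := exists_schwartz_FT2 u
  simpa only [hU] using U.continuous.measurable

theorem measurable_bourgainDensity (s b : ℝ) (u : SchwartzMap (ℝ × ℝ) ℂ) :
    Measurable (bourgainDensity s b u) :=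
  (measurable_wgt s b).ennreal_ofReal.mul ((measurable_FT2 u).enorm.pow_const 2)

theorem ofReal_wgt_mul_sq (s b : ℝ) (q : ℝ × ℝ) (z : ℂ) :
    ENNReal.ofReal (wgt s b q.1 q.2 * ‖z‖ ^ 2) =
      ENNReal.ofReal (wgt s b q.1 q.2) * ‖z‖ₑ ^ 2 := by
  rw [ENNReal.ofReal_mul (wgt_nonneg _ _ _ _), ENNReal.ofReal_pow (norm_nonneg _), ofReal_norm]

theorem lintegral_bourgainDensity (s b : ℝ) (u : SchwartzMap (ℝ × ℝ) ℂ) :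
    ∫⁻ p, bourgainDensity s b u p = ENNReal.ofReal (Xnorm s b u ^ 2) := by
  have h0 : ∀ q : ℝ × ℝ, 0 ≤ wgt s b q.1 q.2 * ‖FT2 u q.1 q.2‖ ^ 2 := fun q =>
    mul_nonneg (wgt_nonneg _ _ _ _) (by positivity)
  rw [Xnorm, Real.sq_sqrt (integral_nonneg h0),
    ofReal_integral_eq_lintegral_ofReal (integrable_wgt_mul s b u) (.of_forall h0)]
  simp only [ofReal_wgt_mul_sq, bourgainDensity]

theorem ofReal_XnormM_sq_le (s b : ℝ) (k : ℕ) (M : (Fin k → ℝ) → ℂ) (u : Fin k → ℝ × ℝ → ℂ) :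
    ENNReal.ofReal (XnormM s b k M u ^ 2) ≤
      ∫⁻ q : ℝ × ℝ, ENNReal.ofReal (wgt s b q.1 q.2) * ‖convFT k M u q.1 q.2‖ₑ ^ 2 := by
  have h0 : ∀ q : ℝ × ℝ, 0 ≤ wgt s b q.1 q.2 * ‖convFT k M u q.1 q.2‖ ^ 2 := fun q =>
    mul_nonneg (wgt_nonneg _ _ _ _) (by positivity)
  rw [XnormM, Real.sq_sqrt (integral_nonneg h0)]
  refine (Real.ofReal_le_enorm _).trans ((enorm_integral_le_lintegral_enorm _).trans_eq ?_)
  simp only [Real.enorm_of_nonneg (h0 _), ofReal_wgt_mul_sq]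

/-- The estimate with explicit exponents when `0 ∈ A`. -/
theorem exists_XnormM_le {k : ℕ} (hk : 1 ≤ k) {s b b' : ℝ} {sv : Fin k → ℝ}
    {M M₁ M₂ : (Fin k → ℝ) → ℝ} (hMmeas : Measurable M) (hM : ∀ ξ, 0 ≤ M ξ)
    {A : Finset (Fin (k + 1))} (h0 : 0 ∈ A) (hA : A ≠ Finset.univ)
    (hM₁meas : Measurable M₁) (hM₂meas : Measurable M₂) (hM₁ : ∀ ξ, 0 ≤ M₁ ξ)
    (hM₂ : ∀ ξ, 0 ≤ M₂ ξ) {C₀ θ : ℝ} (hθ : 0 < θ) (hb : 1 / 2 < b) (hbθ : θ < 2 * b)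
    (hbθ' : θ < 2 * -b') (hfact : ∀ ξ : Fin k → ℝ, Real.sqrt (M₁ ξ * M₂ ξ) =
        M ξ * (1 + (∑ j, ξ j) ^ 2) ^ (s / 2) / ∏ j, (1 + (ξ j) ^ 2) ^ (sv j / 2))
    (hFR₁ : FreqRestricted k M₁ A C₀ θ) (hFR₂ : FreqRestricted k M₂ Aᶜ C₀ θ) :
    ∃ C : ℝ, 0 < C ∧ ∀ v : Fin k → SchwartzMap (ℝ × ℝ) ℂ,
      XnormM s b' k (fun ξ => (M ξ : ℂ)) (fun j => ⇑(v j)) ≤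
        C * ∏ j, Xnorm (sv j) b ⇑(v j) := by
  obtain ⟨m, rfl⟩ : ∃ m, k = m + 1 := ⟨k - 1, by omega⟩
  obtain ⟨j₁, hj₁⟩ : ∃ j, j ∉ A := by simpa [Finset.eq_univ_iff_forall] using hA
  set β : Fin (m + 2) → ℝ := Fin.cons (-b') fun _ => b with hβ
  have hβb : ∀ j ≠ 0, β j = b := fun j hj => by
    obtain ⟨i, rfl⟩ := Fin.exists_succ_eq.2 hj
    simp [hβ]
  have hj₁0 : j₁ ≠ 0 := fun e => hj₁ (e ▸ h0)
  obtain ⟨C₁, hC₁, h₁⟩ := hFR₁.exists_lintegral_japWeight_le (β := β 0) hθ hbθ' hM₁meas hM₁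
  obtain ⟨C₂, hC₂, h₂⟩ := hFR₂.exists_lintegral_japWeight_le (β := β j₁) hθ
    (by rwa [hβb _ hj₁0]) hM₂meas hM₂
  have hfin : ∀ S : Finset (Fin (m + 2)), 0 ∉ S → ∏ j ∈ S, ∫⁻ t, japWeight (β j) t ≠ ⊤ :=
    fun S hS => ENNReal.prod_ne_top fun j hj => by
      rw [hβb j fun e => hS (e ▸ hj)]
      exact lintegral_japWeight_ne_top hb
  set K := (C₁ * ∏ j ∈ A.erase 0, ∫⁻ t, japWeight (β j) t) *
    (C₂ * ∏ j ∈ Aᶜ.erase j₁, ∫⁻ t, japWeight (β j) t)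
  have hK : K ≠ ⊤ := ENNReal.mul_ne_top (ENNReal.mul_ne_top hC₁ (hfin _ (by simp)))
    (ENNReal.mul_ne_top hC₂ (hfin _ (by simp [h0])))
  refine ⟨Real.sqrt K.toReal + 1, by positivity, fun v => ?_⟩
  have hu : ∀ j, Measurable fun p : ℝ × ℝ => FT2 (v j) p.1 p.2 := fun j => measurable_FT2 (v j)
  have hf : ∀ j, Measurable ((Fin.cons 0 fun i => bourgainDensity (sv i) b (v i) :
      Fin (m + 2) → ℝ × ℝ → ENNReal) j) := fun j => by
    refine Fin.cases ?_ (fun i => ?_) j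
    · exact measurable_const
    · exact measurable_bourgainDensity _ _ _
  have hmain := lintegral_sq_lmarginal_le h0 hj₁ (Fin.last_pos' (n := m + 1)).ne'
    (hM₁meas.comp (measurable_tailVec _)).ennreal_ofReal
    (hM₂meas.comp (measurable_tailVec _)).ennreal_ofReal β
    (fun α => h₁ α 0 h0) (fun α => h₂ α j₁ (Finset.mem_compl.2 hj₁)) _ hf
    (w := fun q => ENNReal.ofReal (wgt s b' q.1 q.2)) (measurable_convIntegrand hMmeas hu)
    (fun y hy => (wgt_mul_convIntegrand_sq (b := b) (b' := b') hM hM₁ hM₂ hfact h0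
      (fun j => ⇑(v j)) hy).le) 0
  simp only [Fin.cons_succ, lintegral_bourgainDensity] at hmain
  set D := ∏ j, Xnorm (sv j) b ⇑(v j) with hD
  have hD0 : 0 ≤ D := Finset.prod_nonneg fun j _ => Real.sqrt_nonneg _
  have hle : ENNReal.ofReal (XnormM s b' (m + 1) (fun ξ => (M ξ : ℂ)) (fun j => ⇑(v j)) ^ 2) ≤
      K * ENNReal.ofReal (D ^ 2) := by
    rw [hD, ← Finset.prod_pow, ENNReal.ofReal_prod_of_nonneg fun j _ => sq_nonneg _]
    refine (ofReal_XnormM_sq_le _ _ _ _ _).trans (le_trans (lintegral_mono fun q => ?_) hmain)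
    have := enorm_convFT_le hMmeas hM hu (Function.update 0 0 q)
    rw [Function.update_self] at this
    dsimp only
    gcongr
  rw [← ENNReal.ofReal_toReal hK, ← ENNReal.ofReal_mul ENNReal.toReal_nonneg,
    ENNReal.ofReal_le_ofReal_iff (by positivity)] at hle
  have hsqrt := Real.le_sqrt_of_sq_le hle
  rw [Real.sqrt_mul ENNReal.toReal_nonneg, Real.sqrt_sq hD0] at hsqrt
  linarith

theorem freq_restricted_to_bourgain
    (k : ℕ) (hk : 2 ≤ k) (s : ℝ) (sv : Fin k → ℝ)
    (M : (Fin k → ℝ) → ℝ) (hMmeas : Measurable M) (hMpos : ∀ ξ, 0 ≤ M ξ)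
    (hMpoly : ∃ (C' : ℝ) (p : ℕ), ∀ ξ, |M ξ| ≤ C' * (1 + ‖ξ‖) ^ p)
    (A : Finset (Fin (k + 1))) (hA : A.Nonempty) (hA' : A ≠ Finset.univ)
    (M₁ M₂ : (Fin k → ℝ) → ℝ) (hM₁meas : Measurable M₁) (hM₂meas : Measurable M₂)
    (hM₁pos : ∀ ξ, 0 ≤ M₁ ξ) (hM₂pos : ∀ ξ, 0 ≤ M₂ ξ)
    (C₀ θ : ℝ) (hC₀ : 0 < C₀) (hθ : 0 < θ) (hθ1 : θ < 1)
    (hfact : ∀ ξ : Fin k → ℝ,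
      Real.sqrt (M₁ ξ * M₂ ξ) =
        M ξ * (1 + (∑ j, ξ j) ^ 2) ^ (s / 2) / ∏ j, (1 + (ξ j) ^ 2) ^ (sv j / 2))
    (hFR₁ : FreqRestricted k M₁ A C₀ θ)
    (hFR₂ : FreqRestricted k M₂ Aᶜ C₀ θ) :
    ∃ b b' C : ℝ, 1/2 < b ∧ b < 1 ∧ b - 1 < b' ∧ b' < 0 ∧ 0 < C ∧
      ∀ v : Fin k → SchwartzMap (ℝ × ℝ) ℂ,
        XnormM s b' k (fun ξ => (M ξ : ℂ)) (fun j => ⇑(v j)) ≤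
          C * ∏ j, Xnorm (sv j) b ⇑(v j) := by
  have hb : 1 / 2 < 1 / 2 + (1 - θ) / 8 := by linarith
  have hb1 : 1 / 2 + (1 - θ) / 8 < 1 := by linarith
  have hbθ : θ < 2 * (1 / 2 + (1 - θ) / 8) := by linarith
  refine ⟨1 / 2 + (1 - θ) / 8, -((1 + θ) / 4), ?_⟩
  by_cases h0 : 0 ∈ A
  · obtain ⟨C, hC, h⟩ := exists_XnormM_le (b' := -((1 + θ) / 4)) (by omega) hMmeas hMpos h0 hA'
      hM₁meas hM₂meas hM₁pos hM₂pos hθ hb hbθ (by linarith) hfact hFR₁ hFR₂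
    exact ⟨C, hb, hb1, by linarith, by linarith, hC, h⟩
  · obtain ⟨C, hC, h⟩ := exists_XnormM_le (b' := -((1 + θ) / 4)) (by omega) hMmeas hMpos
      (Finset.mem_compl.2 h0) (by simpa [Finset.nonempty_iff_ne_empty] using hA)
      hM₂meas hM₁meas hM₂pos hM₁pos hθ hb hbθ (by linarith)
      (fun ξ => by rw [mul_comm, hfact]) hFR₂ (by rwa [compl_compl])
    exact ⟨C, hb, hb1, by linarith, by linarith, hC, h⟩

end
end
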